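/- arXiv:2407.07272 — 2 statements merged into one kernel-verified Lean document; each statement's English description precedes it below -/
import Mathlib

section
/- Let G be a spray on a nonempty open set U ⊆ ℝ^n (n ≥ 2) and dV a volume form on U. Then the Weyl-type curvature of the projective spray Ĝ of (G,dV) equals the Weyl curvature of G: R̂^i_k − (R̂ δ^i_k − ½ R̂_{·k} y^i) = T^i_k + (3χ_k/(n+1)) y^i, where T^i_k := R^i_k − (R δ^i_k − ½ R_{·k} y^i) and χ_i := −(1/3) T^m_{i·m}. In particular the left-hand side is independent of the choice of the volume form dV. -/
open scoped BigOperators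
open MeasureTheory

noncomputable section BerwaldWeyl

/-- Points/vectors in local coordinates on `ℝⁿ`. -/
abbrev Vec (n : ℕ) := Fin n → ℝ

/-- Partial derivative in the base (`x`) variable along the `i`-th coordinate. -/
def pdx {n : ℕ} (f : Vec n → Vec n → ℝ) (i : Fin n) : Vec n → Vec n → ℝ :=
  fun x y => fderiv ℝ (fun x' => f x' y) x (Pi.single i 1)

/-- Vertical derivative `f_{·i} = ∂f/∂y^i`. -/
def pdy {n : ℕ} (f : Vec n → Vec n → ℝ) (i : Fin n) : Vec n → Vec n → ℝ :=
  fun x y => fderiv ℝ (fun y' => f x y') y (Pi.single i 1)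

/-- The slit fiber `ℝⁿ \ {0}`. -/
def slit (n : ℕ) : Set (Vec n) := {y | y ≠ 0}

/-- A spray on `U ⊆ ℝⁿ`: a family `G^i(x,y)`, smooth on `U × (ℝⁿ \ {0})` and
positively 2-homogeneous in `y`. -/
def IsSpray {n : ℕ} (U : Set (Vec n)) (G : Fin n → Vec n → Vec n → ℝ) : Prop :=
  (∀ i, ContDiffOn ℝ (⊤ : ℕ∞) (fun p : Vec n × Vec n => G i p.1 p.2) (U ×ˢ slit n)) ∧
  (∀ i, ∀ x ∈ U, ∀ y ∈ slit n, ∀ c : ℝ, 0 < c → G i x (c • y) = c ^ 2 * G i x y)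

/-- Nonlinear connection coefficients `N^i_j := ∂G^i/∂y^j`. -/
def Nc {n : ℕ} (G : Fin n → Vec n → Vec n → ℝ) (i j : Fin n) : Vec n → Vec n → ℝ :=
  pdy (G i) j

/-- Berwald connection coefficients `Γ^i_{jk} := ∂²G^i/∂y^j∂y^k`. -/
def Γc {n : ℕ} (G : Fin n → Vec n → Vec n → ℝ) (i j k : Fin n) : Vec n → Vec n → ℝ :=
  pdy (pdy (G i) j) k

/-- Horizontal derivative of a scalar: `f_{|k} := δf/δx^k = ∂f/∂x^k - N^l_k ∂f/∂y^l`. -/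
def hD {n : ℕ} (G : Fin n → Vec n → Vec n → ℝ) (f : Vec n → Vec n → ℝ) (k : Fin n) :
    Vec n → Vec n → ℝ :=
  fun x y => pdx f k x y - ∑ l, Nc G l k x y * pdy f l x y

/-- Horizontal covariant derivative `A_{j|m}` of a 1-form `A_j`. -/
def covD1 {n : ℕ} (G : Fin n → Vec n → Vec n → ℝ) (A : Fin n → Vec n → Vec n → ℝ)
    (j m : Fin n) : Vec n → Vec n → ℝ :=
  fun x y => hD G (A j) m x y - ∑ l, A l x y * Γc G l j m x y

/-- Horizontal covariant derivative `A^i_{j|m}` of a (1,1)-tensor `A^i_j`. -/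
def covD11 {n : ℕ} (G : Fin n → Vec n → Vec n → ℝ)
    (A : Fin n → Fin n → Vec n → Vec n → ℝ) (i j m : Fin n) : Vec n → Vec n → ℝ :=
  fun x y => hD G (A i j) m x y + ∑ l, A l j x y * Γc G i l m x y
    - ∑ l, A i l x y * Γc G l j m x y

/-- Horizontal covariant derivative `B^i_{jk|m}` of a (1,2)-tensor `B^i_{jk}`. -/
def covD12 {n : ℕ} (G : Fin n → Vec n → Vec n → ℝ)
    (B : Fin n → Fin n → Fin n → Vec n → Vec n → ℝ) (i j k m : Fin n) : Vec n → Vec n → ℝ :=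
  fun x y => hD G (B i j k) m x y + ∑ l, B l j k x y * Γc G i l m x y
    - ∑ l, B i l k x y * Γc G l j m x y - ∑ l, B i j l x y * Γc G l k m x y

/-- Riemann curvature `R^i_k`. -/
def Riem {n : ℕ} (G : Fin n → Vec n → Vec n → ℝ) (i k : Fin n) : Vec n → Vec n → ℝ :=
  fun x y => 2 * pdx (G i) k x y - ∑ j, y j * pdy (pdx (G i) j) k x y
    + 2 * ∑ j, G j x y * Γc G i j k x y - ∑ s, Nc G i s x y * Nc G s k x y

/-- Ricci scalar `R := R^m_m/(n-1)`. -/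
def Ricci {n : ℕ} (G : Fin n → Vec n → Vec n → ℝ) : Vec n → Vec n → ℝ :=
  fun x y => (∑ m, Riem G m m x y) / ((n : ℝ) - 1)

/-- The Weyl-type curvature `T^i_k := R^i_k - (R δ^i_k - ½ R_{·k} y^i)`. -/
def Tcurv {n : ℕ} (G : Fin n → Vec n → Vec n → ℝ) (i k : Fin n) : Vec n → Vec n → ℝ :=
  fun x y => Riem G i k x y -
    (Ricci G x y * (if i = k then 1 else 0) - (1/2) * pdy (Ricci G) k x y * y i)

/-- The χ-curvature `χ_i := -(1/3) T^m_{i·m}`. -/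
def chiC {n : ℕ} (G : Fin n → Vec n → Vec n → ℝ) (i : Fin n) : Vec n → Vec n → ℝ :=
  fun x y => -(1/3) * ∑ m, pdy (Tcurv G m i) m x y

/-- The Weyl curvature `W^i_k := T^i_k + (3χ_k/(n+1)) y^i`. -/
def Weyl {n : ℕ} (G : Fin n → Vec n → Vec n → ℝ) (i k : Fin n) : Vec n → Vec n → ℝ :=
  fun x y => Tcurv G i k x y + (3 * chiC G k x y / ((n : ℝ) + 1)) * y i

/-- A volume form `dV = σ(x) dx` on `U`: `σ` smooth and positive. -/
def IsVolumeForm {n : ℕ} (U : Set (Vec n)) (σ : Vec n → ℝ) : Prop :=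
  ContDiffOn ℝ (⊤ : ℕ∞) σ U ∧ ∀ x ∈ U, 0 < σ x

/-- The S-curvature of `(G, dV)`: `S := ∂G^m/∂y^m - y^m ∂(ln σ)/∂x^m`. -/
def Scurv {n : ℕ} (G : Fin n → Vec n → Vec n → ℝ) (σ : Vec n → ℝ) : Vec n → Vec n → ℝ :=
  fun x y => ∑ m, Nc G m m x y
    - ∑ m, y m * fderiv ℝ (fun x' => Real.log (σ x')) x (Pi.single m 1)

/-- The projective spray `Ĝ^i := G^i - (S/(n+1)) y^i` of `(G, dV)`. -/
def Ghat {n : ℕ} (G : Fin n → Vec n → Vec n → ℝ) (σ : Vec n → ℝ) :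
    Fin n → Vec n → Vec n → ℝ :=
  fun i x y => G i x y - (Scurv G σ x y / ((n : ℝ) + 1)) * y i

/-- The Berwald–Weyl curvature `W^o_k := R̂_{∥k} - ½ R̂_{·k∥m} y^m` of `(G, dV)`,
where all hatted quantities and `∥` are taken with respect to the projective spray `Ĝ`. -/
def BWeyl {n : ℕ} (G : Fin n → Vec n → Vec n → ℝ) (σ : Vec n → ℝ) (k : Fin n) :
    Vec n → Vec n → ℝ :=
  fun x y => hD (Ghat G σ) (Ricci (Ghat G σ)) k x y
    - (1/2) * ∑ m, covD1 (Ghat G σ) (fun j => pdy (Ricci (Ghat G σ)) j) k m x y * y m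

/-- A commutative algebra with coordinate derivations `∂/∂xⁱ`, `∂/∂yⁱ` and fiber coordinates `yⁱ`,
modelled on the smooth functions on an open subset of the tangent bundle of `ℝⁿ`. -/
structure PhaseAlgebra (n : ℕ) (A : Type*) [CommRing A] [Algebra ℝ A] where
  /-- The derivations `∂/∂xⁱ`. -/
  X : Fin n → Derivation ℝ A A
  /-- The derivations `∂/∂yⁱ`. -/
  Y : Fin n → Derivation ℝ A A
  /-- The fiber coordinates. -/
  y : Fin n → A
  X_X : ∀ i j f, X i (X j f) = X j (X i f)
  X_Y : ∀ i j f, X i (Y j f) = Y j (X i f)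
  Y_Y : ∀ i j f, Y i (Y j f) = Y j (Y i f)
  X_y : ∀ i j, X i (y j) = 0
  Y_y : ∀ i j, Y i (y j) = if i = j then 1 else 0

namespace PhaseAlgebra

variable {n : ℕ} {A : Type*} [CommRing A] [Algebra ℝ A] (Φ : PhaseAlgebra n A)

/-- The Euler (Liouville) field `yʲ ∂/∂yʲ`. -/
def euler : Derivation ℝ A A := ∑ j, Φ.y j • Φ.Y j

/-- The vector field `yʲ ∂/∂xʲ - 2 Gʲ ∂/∂yʲ` of a spray. -/
def field (G : Fin n → A) : Derivation ℝ A A :=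
  ∑ j, (Φ.y j • Φ.X j - (2 * G j) • Φ.Y j)

/-- The Riemann curvature of a spray, written with the spray vector field. -/
def riem (G : Fin n → A) (i k : Fin n) : A :=
  2 * Φ.X k (G i) - Φ.field G (Φ.Y k (G i)) - ∑ s, Φ.Y s (G i) * Φ.Y k (G s)

/-- The Euler–Lagrange type operator `f ↦ ∂f/∂xᵏ - D(∂f/∂yᵏ)` along the spray field `D`. -/
def lagr (G : Fin n → A) (k : Fin n) (f : A) : A :=
  Φ.X k f - Φ.field G (Φ.Y k f)

/-- The coefficient of `δⁱₖ` in the change of the Riemann curvature under `G ↦ G + P y`. -/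
def projScalar (G : Fin n → A) (P : A) : A := P * P - Φ.field G P

/-- The coefficient of `yⁱ` in the change of the Riemann curvature under `G ↦ G + P y`. -/
def projForm (G : Fin n → A) (P : A) (k : Fin n) : A :=
  2 * Φ.X k P - Φ.field G (Φ.Y k P) - ∑ s, Φ.Y s P * Φ.Y k (G s) - P * Φ.Y k P

theorem derivation_sum_apply (D : Fin n → Derivation ℝ A A) (f : A) :
    (∑ j, D j) f = ∑ j, D j f := by
  rw [← Derivation.coeFnAddMonoidHom_apply, map_sum, Finset.sum_apply]
  rfl

theorem euler_apply (f : A) : Φ.euler f = ∑ j, Φ.y j * Φ.Y j f := by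
  simp [euler, derivation_sum_apply]

theorem field_apply (G : Fin n → A) (f : A) :
    Φ.field G f = ∑ j, Φ.y j * Φ.X j f - 2 * ∑ j, G j * Φ.Y j f := by
  simp [field, derivation_sum_apply, Finset.sum_sub_distrib, Finset.mul_sum, mul_assoc]

theorem derivation_two (D : Derivation ℝ A A) : D (2 : A) = 0 := by
  exact_mod_cast D.map_natCast 2

theorem euler_Y (k : Fin n) (f : A) : Φ.euler (Φ.Y k f) = Φ.Y k (Φ.euler f) - Φ.Y k f := by
  simp [euler_apply, Φ.Y_y, Finset.sum_add_distrib, Φ.Y_Y k]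

theorem euler_X (k : Fin n) (f : A) : Φ.euler (Φ.X k f) = Φ.X k (Φ.euler f) := by
  simp [euler_apply, Φ.X_y, Φ.X_Y k]

theorem Y_field (G : Fin n → A) (k : Fin n) (f : A) :
    Φ.Y k (Φ.field G f) =
      Φ.X k f + Φ.field G (Φ.Y k f) - 2 * ∑ j, Φ.Y k (G j) * Φ.Y j f := by
  simp only [field_apply, map_sub, map_sum, Derivation.leibniz, smul_eq_mul, Φ.Y_y, Φ.X_Y,
    Φ.Y_Y k, derivation_two, mul_ite, mul_one, mul_zero, Finset.sum_add_distrib,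
    Finset.sum_ite_eq, Finset.mem_univ, if_true, add_zero]
  simp only [mul_comm (Φ.Y _ f)]
  ring

theorem field_y (G : Fin n → A) (i : Fin n) : Φ.field G (Φ.y i) = -2 * G i := by
  simp [field_apply, Φ.X_y, Φ.Y_y]

theorem euler_y (i : Fin n) : Φ.euler (Φ.y i) = Φ.y i := by
  simp [euler_apply, Φ.Y_y]

variable {G : Fin n → A}

theorem euler_field (hG : ∀ i, Φ.euler (G i) = 2 * G i) (f : A) :
    Φ.euler (Φ.field G f) = Φ.field G (Φ.euler f) + Φ.field G f := by
  simp only [field_apply Φ G, map_sub, map_sum, Derivation.leibniz, smul_eq_mul, euler_y, euler_X,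
    euler_Y, derivation_two, mul_zero, add_zero, hG, Finset.sum_add_distrib, mul_sub,
    Finset.sum_sub_distrib]
  have h : ∑ j, Φ.Y j f * (2 * G j) = 2 * ∑ j, G j * Φ.Y j f := by
    rw [Finset.mul_sum]
    exact Finset.sum_congr rfl fun j _ => by ring
  have h' : ∑ j, Φ.X j f * Φ.y j = ∑ j, Φ.y j * Φ.X j f :=
    Finset.sum_congr rfl fun j _ => by ring
  rw [h, h']
  ring

theorem euler_riem (hG : ∀ i, Φ.euler (G i) = 2 * G i) (i k : Fin n) :
    Φ.euler (Φ.riem G i k) = 2 * Φ.riem G i k := by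
  have hN : ∀ i k, Φ.euler (Φ.Y k (G i)) = Φ.Y k (G i) := fun i k => by
    rw [euler_Y, hG, Derivation.leibniz, derivation_two]
    simp only [smul_eq_mul]
    ring
  have h : ∑ s, (Φ.Y s (G i) * Φ.Y k (G s) + Φ.Y k (G s) * Φ.Y s (G i)) =
      2 * ∑ s, Φ.Y s (G i) * Φ.Y k (G s) := by
    rw [Finset.mul_sum]
    exact Finset.sum_congr rfl fun j _ => by ring
  simp only [riem, map_sub, map_sum, Derivation.leibniz, smul_eq_mul, Φ.euler_field hG, euler_X,
    hN, hG, derivation_two, h]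
  ring

/-- The change of the Riemann curvature under a projective change `Gⁱ ↦ Gⁱ + P yⁱ`. -/
theorem riem_add_mul_y (hG : ∀ i, Φ.euler (G i) = 2 * G i) {P : A} (hP : Φ.euler P = P)
    (i k : Fin n) :
    Φ.riem (fun j => G j + P * Φ.y j) i k =
      Φ.riem G i k + Φ.projScalar G P * (if k = i then 1 else 0) + Φ.projForm G P k * Φ.y i := by
  have hF : ∀ f, Φ.field (fun j => G j + P * Φ.y j) f = Φ.field G f - 2 * (P * Φ.euler f) := by
    intro f
    simp only [field_apply, euler_apply, add_mul, Finset.sum_add_distrib, mul_assoc,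
      ← Finset.mul_sum]
    ring
  have hδ : Φ.field G (if k = i then (1 : A) else 0) = 0 := by split_ifs <;> simp
  have hδ' : Φ.euler (if k = i then (1 : A) else 0) = 0 := by split_ifs <;> simp
  have hsum : ∑ s, (Φ.Y s (G i) + (P * (if s = i then 1 else 0) + Φ.y i * Φ.Y s P)) *
      (Φ.Y k (G s) + (P * (if k = s then 1 else 0) + Φ.y s * Φ.Y k P)) =
      ∑ s, Φ.Y s (G i) * Φ.Y k (G s) + P * Φ.Y k (G i) + Φ.Y k P * (2 * G i)
      + P * (Φ.Y k (G i) + (P * (if k = i then 1 else 0) + Φ.y i * Φ.Y k P))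
      + Φ.y i * (∑ s, Φ.Y s P * Φ.Y k (G s)) + Φ.y i * P * Φ.Y k P
      + Φ.y i * Φ.Y k P * P := by
    have e1 : ∑ s, Φ.y s * Φ.Y s (G i) = 2 * G i := by rw [← euler_apply, hG]
    have e2 : ∑ s, Φ.y s * Φ.Y s P = P := by rw [← euler_apply, hP]
    have e3 : ∑ s, (Φ.Y s (G i) * if k = s then 1 else 0) = Φ.Y k (G i) := by simp
    have e4 : ∑ s, (Φ.Y s P * if k = s then 1 else 0) = Φ.Y k P := by simp
    have e5 : ∑ s, (if s = i then 1 else 0) *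
        (Φ.Y k (G s) + (P * (if k = s then 1 else 0) + Φ.y s * Φ.Y k P)) =
        Φ.Y k (G i) + (P * (if k = i then 1 else 0) + Φ.y i * Φ.Y k P) := by simp
    calc _ = ∑ s, Φ.Y s (G i) * Φ.Y k (G s)
          + P * (∑ s, (Φ.Y s (G i) * if k = s then 1 else 0))
          + Φ.Y k P * (∑ s, Φ.y s * Φ.Y s (G i))
          + P * (∑ s, (if s = i then 1 else 0) *
            (Φ.Y k (G s) + (P * (if k = s then 1 else 0) + Φ.y s * Φ.Y k P)))
          + Φ.y i * (∑ s, Φ.Y s P * Φ.Y k (G s))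
          + Φ.y i * P * (∑ s, (Φ.Y s P * if k = s then 1 else 0))
          + Φ.y i * Φ.Y k P * (∑ s, Φ.y s * Φ.Y s P) := by
          simp only [Finset.mul_sum, ← Finset.sum_add_distrib]
          exact Finset.sum_congr rfl fun s _ => by ring
      _ = _ := by rw [e1, e2, e3, e4, e5]
  have hN : Φ.euler (Φ.Y k (G i)) = Φ.Y k (G i) := by
    rw [euler_Y, hG, Derivation.leibniz, derivation_two]
    simp only [smul_eq_mul]
    ring
  have hPk : Φ.euler (Φ.Y k P) = 0 := by rw [euler_Y, hP, sub_self]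
  simp only [riem, hF, map_add, Derivation.leibniz, smul_eq_mul, Φ.Y_y, Φ.X_y, hsum, field_y,
    euler_y, hδ, hδ', hN, hPk, hP, projScalar, projForm]
  ring

theorem sum_projForm_mul_y (hG : ∀ i, Φ.euler (G i) = 2 * G i) {P : A} (hP : Φ.euler P = P) :
    ∑ k, Φ.projForm G P k * Φ.y k = -Φ.projScalar G P := by
  have h1 : ∑ k, Φ.y k * Φ.field G (Φ.Y k P) = Φ.field G P + 2 * ∑ k, G k * Φ.Y k P := by
    have h := congrArg (Φ.field G) hP
    rw [euler_apply, map_sum] at h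
    simp only [Derivation.leibniz, smul_eq_mul, field_y, Finset.sum_add_distrib] at h
    rw [← h, Finset.mul_sum, add_assoc, ← Finset.sum_add_distrib]
    rw [Finset.sum_eq_zero (f := fun i => Φ.Y i P * (-2 * G i) + 2 * (G i * Φ.Y i P)), add_zero]
    intro i _
    ring
  have h2 : ∑ k, (∑ s, Φ.Y s P * Φ.Y k (G s)) * Φ.y k = 2 * ∑ k, G k * Φ.Y k P := by
    simp only [Finset.sum_mul]
    rw [Finset.sum_comm, Finset.mul_sum]
    refine Finset.sum_congr rfl fun s _ => ?_
    have := hG s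
    rw [euler_apply] at this
    calc _ = Φ.Y s P * ∑ k, Φ.y k * Φ.Y k (G s) := by
          rw [Finset.mul_sum]
          exact Finset.sum_congr rfl fun k _ => by ring
      _ = _ := by rw [this]; ring
  have h3 : ∑ k, Φ.y k * Φ.Y k P = P := by rw [← euler_apply, hP]
  calc _ = 2 * ∑ k, Φ.y k * Φ.X k P - ∑ k, Φ.y k * Φ.field G (Φ.Y k P)
        - ∑ k, (∑ s, Φ.Y s P * Φ.Y k (G s)) * Φ.y k - P * ∑ k, Φ.y k * Φ.Y k P := by
        simp only [Finset.mul_sum, ← Finset.sum_sub_distrib, projForm]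
        exact Finset.sum_congr rfl fun s _ => by ring
    _ = _ := by
        rw [h1, h2, h3, projScalar, field_apply]
        ring

theorem two_mul_projForm_add (G : Fin n → A) (P : A) (k : Fin n) :
    2 * Φ.projForm G P k + Φ.Y k (Φ.projScalar G P) = 3 * Φ.lagr G k P := by
  have h : ∑ s, Φ.Y s P * Φ.Y k (G s) = ∑ s, Φ.Y k (G s) * Φ.Y s P :=
    Finset.sum_congr rfl fun s _ => by ring
  simp only [projForm, projScalar, lagr, map_sub, Derivation.leibniz, smul_eq_mul, Y_field, h]
  ring

theorem sum_riem_add_mul_y (hG : ∀ i, Φ.euler (G i) = 2 * G i) {P : A} (hP : Φ.euler P = P) :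
    ∑ m, Φ.riem (fun j => G j + P * Φ.y j) m m =
      ∑ m, Φ.riem G m m + (n - 1) * Φ.projScalar G P := by
  simp only [Φ.riem_add_mul_y hG hP, Finset.sum_add_distrib, Φ.sum_projForm_mul_y hG hP]
  simp
  ring

theorem two_mul_sum_Y_riem (G : Fin n → A) (k : Fin n) :
    2 * ∑ m, Φ.Y m (Φ.riem G m k) + Φ.Y k (∑ m, Φ.riem G m m) =
      3 * Φ.lagr G k (∑ m, Φ.Y m (G m)) := by
  have hab : ∑ m, ∑ s, Φ.Y m (G s) * Φ.Y k (Φ.Y s (G m)) =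
      ∑ m, ∑ s, Φ.Y s (G m) * Φ.Y k (Φ.Y m (G s)) := Finset.sum_comm
  have h1 : ∀ m, Φ.Y m (Φ.riem G m k) = 2 * Φ.X k (Φ.Y m (G m)) - Φ.X m (Φ.Y k (G m))
      - Φ.field G (Φ.Y k (Φ.Y m (G m))) + 2 * ∑ s, Φ.Y m (G s) * Φ.Y k (Φ.Y s (G m))
      - ∑ s, Φ.Y k (G s) * Φ.Y m (Φ.Y s (G m))
      - ∑ s, Φ.Y s (G m) * Φ.Y k (Φ.Y m (G s)) := by
    intro m
    simp only [riem, map_sub, map_sum, Derivation.leibniz, smul_eq_mul, Y_field, derivation_two,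
      Finset.sum_add_distrib, Φ.Y_Y _ k, Φ.X_Y]
    ring
  have h2 : ∀ m, Φ.Y k (Φ.riem G m m) = 2 * Φ.X m (Φ.Y k (G m)) - Φ.X k (Φ.Y m (G m))
      - Φ.field G (Φ.Y k (Φ.Y m (G m))) + 2 * ∑ s, Φ.Y k (G s) * Φ.Y m (Φ.Y s (G m))
      - ∑ s, Φ.Y m (G s) * Φ.Y k (Φ.Y s (G m))
      - ∑ s, Φ.Y s (G m) * Φ.Y k (Φ.Y m (G s)) := by
    intro m
    simp only [riem, map_sub, map_sum, Derivation.leibniz, smul_eq_mul, Y_field, derivation_two,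
      Finset.sum_add_distrib, Φ.Y_Y m, Φ.X_Y]
    ring
  simp only [lagr, map_sum, h1, h2, Finset.sum_add_distrib, Finset.sum_sub_distrib,
    ← Finset.mul_sum, hab]
  ring

theorem lagr_trace (G F : Fin n → A) (hF : ∀ i k, Φ.Y k (F i) = 0)
    (hXF : ∀ i k, Φ.X k (F i) = Φ.X i (F k)) (k : Fin n) :
    Φ.lagr G k (∑ m, Φ.y m * F m) = 0 := by
  simp [lagr, field_apply, Φ.X_y, Φ.Y_y, hF, hXF _ k]

/-- The Ricci scalar of a spray. -/
def ric (G : Fin n → A) : A := ((n : ℝ) - 1)⁻¹ • ∑ m, Φ.riem G m m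

/-- The Weyl-type curvature of a spray. -/
def tcurv (G : Fin n → A) (i k : Fin n) : A :=
  Φ.riem G i k - (Φ.ric G * (if i = k then 1 else 0)
    - (1 / 2 : ℝ) • (Φ.Y k (Φ.ric G) * Φ.y i))

theorem two_mul_smul_half (f : A) : 2 * ((1 / 2 : ℝ) • f) = f := by
  rw [mul_smul_comm, two_mul, smul_add, ← add_smul]
  norm_num

theorem two_mul_sum_Y_tcurv (hn : (n : ℝ) - 1 ≠ 0) (hG : ∀ i, Φ.euler (G i) = 2 * G i)
    (k : Fin n) :
    2 * ∑ m, Φ.Y m (Φ.tcurv G m k) = 3 * Φ.lagr G k (∑ m, Φ.Y m (G m)) := by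
  have hE : Φ.euler (Φ.ric G) = 2 * Φ.ric G := by
    simp only [ric, Derivation.map_smul, map_sum, Φ.euler_riem hG, ← Finset.mul_sum,
      mul_smul_comm]
  have hr : ((n : A) - 1) * Φ.Y k (Φ.ric G) = Φ.Y k (∑ m, Φ.riem G m m) := by
    have h : ((n : A) - 1) = algebraMap ℝ A ((n : ℝ) - 1) := by simp
    rw [ric, Derivation.map_smul, h, ← Algebra.smul_def, smul_smul, mul_inv_cancel₀ hn, one_smul]
  have hEk : ∑ m, Φ.y m * Φ.Y m (Φ.Y k (Φ.ric G)) = Φ.Y k (Φ.ric G) := by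
    rw [← euler_apply, euler_Y, hE, Derivation.leibniz, derivation_two]
    simp only [smul_eq_mul]
    ring
  have hδ : ∀ m, Φ.Y m (if m = k then (1 : A) else 0) = 0 := fun m => by split_ifs <;> simp
  have h : ∀ m, 2 * Φ.Y m (Φ.tcurv G m k) = 2 * Φ.Y m (Φ.riem G m k)
      - 2 * ((if m = k then 1 else 0) * Φ.Y m (Φ.ric G))
      + (Φ.Y k (Φ.ric G) + Φ.y m * Φ.Y m (Φ.Y k (Φ.ric G))) := by
    intro m
    simp only [tcurv, map_sub, Derivation.map_smul, Derivation.leibniz, hδ, Φ.Y_y, smul_eq_mul,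
      if_true, mul_sub, two_mul_smul_half]
    ring
  rw [← two_mul_sum_Y_riem, ← hr, Finset.mul_sum, Finset.sum_congr rfl fun m _ => h m,
    Finset.sum_add_distrib, Finset.sum_add_distrib, Finset.sum_sub_distrib, hEk]
  simp [Finset.mul_sum]
  ring

/-- The Weyl-type curvature of the projective spray `Gⁱ - S / (n + 1) yⁱ`, where `S` is the trace
of `∂Gⁱ/∂yʲ` minus a closed `1`-form `F` on the base. -/
theorem tcurv_projective (hn : (n : ℝ) - 1 ≠ 0) (hG : ∀ i, Φ.euler (G i) = 2 * G i)
    (F : Fin n → A) (hF : ∀ i k, Φ.Y k (F i) = 0) (hXF : ∀ i k, Φ.X k (F i) = Φ.X i (F k))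
    {P : A} (hP : P = (-((n : ℝ) + 1)⁻¹) • (∑ m, Φ.Y m (G m) - ∑ m, Φ.y m * F m))
    (i k : Fin n) :
    Φ.tcurv (fun j => G j + P * Φ.y j) i k =
      Φ.tcurv G i k + (-((n : ℝ) + 1)⁻¹) • ((∑ m, Φ.Y m (Φ.tcurv G m k)) * Φ.y i) := by
  have hN : ∀ m, Φ.euler (Φ.Y m (G m)) = Φ.Y m (G m) := fun m => by
    rw [euler_Y, hG, Derivation.leibniz, derivation_two]
    simp only [smul_eq_mul]
    ring
  have hEF : ∀ m, Φ.euler (F m) = 0 := fun m => by simp [euler_apply, hF]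
  have hEP : Φ.euler P = P := by
    simp [hP, Derivation.map_smul, hN, hEF, euler_y, mul_comm]
  have hric : Φ.ric (fun j => G j + P * Φ.y j) = Φ.ric G + Φ.projScalar G P := by
    have h : ((n : A) - 1) = algebraMap ℝ A ((n : ℝ) - 1) := by simp
    rw [ric, Φ.sum_riem_add_mul_y hG hEP, smul_add, h, ← Algebra.smul_def, smul_smul,
      inv_mul_cancel₀ hn, one_smul, ric]
  have hlagr : Φ.lagr G k P = (-((n : ℝ) + 1)⁻¹) • Φ.lagr G k (∑ m, Φ.Y m (G m)) := by
    have h := Φ.lagr_trace G F hF hXF k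
    simp only [lagr] at h ⊢
    rw [hP, Derivation.map_smul, Derivation.map_smul, Derivation.map_smul, ← smul_sub, map_sub,
      map_sub, map_sub]
    congr 1
    linear_combination -h
  have hkey : 2 * Φ.projForm G P k + Φ.Y k (Φ.projScalar G P) =
      2 * ((-((n : ℝ) + 1)⁻¹) • ∑ m, Φ.Y m (Φ.tcurv G m k)) := by
    rw [two_mul_projForm_add, hlagr, mul_smul_comm, ← Φ.two_mul_sum_Y_tcurv hn hG, mul_smul_comm]
  have hhalf : Φ.projForm G P k + (1 / 2 : ℝ) • Φ.Y k (Φ.projScalar G P) =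
      (-((n : ℝ) + 1)⁻¹) • ∑ m, Φ.Y m (Φ.tcurv G m k) := by
    have h : ∀ f : A, (1 / 2 : ℝ) • (2 * f) = f := fun f => by
      rw [← mul_smul_comm, two_mul_smul_half]
    rw [← h ((-((n : ℝ) + 1)⁻¹) • _), ← hkey, smul_add, h]
  rw [← smul_mul_assoc, ← hhalf, tcurv, tcurv, hric, Φ.riem_add_mul_y hG hEP, map_add]
  simp only [eq_comm (a := k), add_mul, smul_add, smul_mul_assoc]
  ring

end PhaseAlgebra
section SmoothFunctions

variable {E : Type*} [NormedAddCommGroup E] [NormedSpace ℝ E]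

/-- The algebra of smooth real functions on a set `s`. -/
def smoothOn (s : Set E) : Subalgebra ℝ (s → ℝ) where
  carrier := {f | ∃ F : E → ℝ, ContDiffOn ℝ (⊤ : ℕ∞) F s ∧ ∀ p : s, F p = f p}
  mul_mem' := by
    rintro f g ⟨F, hF, hf⟩ ⟨G, hG, hg⟩
    exact ⟨fun p => F p * G p, hF.mul hG, fun p => by simp [hf, hg]⟩
  add_mem' := by
    rintro f g ⟨F, hF, hf⟩ ⟨G, hG, hg⟩
    exact ⟨fun p => F p + G p, hF.add hG, fun p => by simp [hf, hg]⟩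
  algebraMap_mem' r := ⟨fun _ => r, contDiffOn_const, fun _ => rfl⟩

variable {s : Set E}

namespace smoothOn

/-- The element of `smoothOn s` given by a function which is smooth on `s`. -/
def mk (F : E → ℝ) (hF : ContDiffOn ℝ (⊤ : ℕ∞) F s) : smoothOn s :=
  ⟨fun p => F p, F, hF, fun _ => rfl⟩

theorem contDiffOn (f : smoothOn s) {F : E → ℝ} (hF : ∀ p : s, F p = f.1 p) :
    ContDiffOn ℝ (⊤ : ℕ∞) F s := by
  obtain ⟨H, hH, h⟩ := f.2
  exact hH.congr fun p hp => (hF ⟨p, hp⟩).trans (h ⟨p, hp⟩).symm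

theorem differentiableAt (hs : IsOpen s) (f : smoothOn s) {F : E → ℝ}
    (hF : ∀ p : s, F p = f.1 p) (p : s) : DifferentiableAt ℝ F p :=
  ((contDiffOn f hF).contDiffAt (hs.mem_nhds p.2)).differentiableAt (by simp)

theorem contDiffOn_fderiv_apply (hs : IsOpen s) (f : smoothOn s) {F : E → ℝ}
    (hF : ∀ p : s, F p = f.1 p) (v : E) :
    ContDiffOn ℝ (⊤ : ℕ∞) (fun p => fderiv ℝ F p v) s :=
  ((contDiffOn f hF).fderiv_of_isOpen hs (by simp)).clm_apply contDiffOn_const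

theorem fderiv_congr (hs : IsOpen s) {F F' : E → ℝ} (h : ∀ p : s, F p = F' p) (p : s) :
    fderiv ℝ F p = fderiv ℝ F' p :=
  Filter.EventuallyEq.fderiv_eq <|
    Filter.eventually_of_mem (hs.mem_nhds p.2) fun q hq => h ⟨q, hq⟩

/-- An extension of a smooth function on `s` to the whole space. -/
def ext (f : smoothOn s) : E → ℝ := f.2.choose

theorem ext_apply (f : smoothOn s) (p : s) : ext f p = f.1 p := f.2.choose_spec.2 p

/-- The directional derivative on smooth functions on an open set. -/
def dir (hs : IsOpen s) (v : E) : Derivation ℝ (smoothOn s) (smoothOn s) :=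
  Derivation.mk'
    { toFun := fun f => mk (fun p => fderiv ℝ (ext f) p v)
        (contDiffOn_fderiv_apply hs f (ext_apply f) v)
      map_add' := fun f g => by
        refine Subtype.ext (funext fun p => ?_)
        change fderiv ℝ (ext (f + g)) p v = fderiv ℝ (ext f) p v + fderiv ℝ (ext g) p v
        rw [fderiv_congr hs (F' := fun q => ext f q + ext g q) (fun q => by
          simp [ext_apply]), fderiv_fun_add (differentiableAt hs f (ext_apply f) p)
            (differentiableAt hs g (ext_apply g) p)]
        rfl
      map_smul' := fun c f => by
        refine Subtype.ext (funext fun p => ?_)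
        change fderiv ℝ (ext (c • f)) p v = c * fderiv ℝ (ext f) p v
        rw [fderiv_congr hs (F' := fun q => c * ext f q) (fun q => by
          simp [ext_apply]), fderiv_const_mul (differentiableAt hs f (ext_apply f) p)]
        rfl }
    fun f g => by
      refine Subtype.ext (funext fun p => ?_)
      change fderiv ℝ (ext (f * g)) p v =
        f.1 p * fderiv ℝ (ext g) p v + g.1 p * fderiv ℝ (ext f) p v
      rw [fderiv_congr hs (F' := fun q => ext f q * ext g q) (fun q => by
        simp [ext_apply]), fderiv_fun_mul (differentiableAt hs f (ext_apply f) p)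
          (differentiableAt hs g (ext_apply g) p)]
      simp [ext_apply]

theorem dir_apply (hs : IsOpen s) (v : E) (f : smoothOn s) {F : E → ℝ}
    (hF : ∀ p : s, F p = f.1 p) (p : s) : (dir hs v f).1 p = fderiv ℝ F p v := by
  change fderiv ℝ (ext f) p v = _
  rw [fderiv_congr hs fun q => (ext_apply f q).trans (hF q).symm]

theorem dir_comm (hs : IsOpen s) (v w : E) (f : smoothOn s) :
    dir hs v (dir hs w f) = dir hs w (dir hs v f) := by
  refine Subtype.ext (funext fun p => ?_)
  have h2 : ((2 : ℕ∞) : WithTop ℕ∞) ≤ (⊤ : ℕ∞) := by exact_mod_cast le_top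
  have hf : ContDiffAt ℝ (⊤ : ℕ∞) (ext f) p :=
    (contDiffOn f (ext_apply f)).contDiffAt (hs.mem_nhds p.2)
  have hd : DifferentiableAt ℝ (fderiv ℝ (ext f)) p :=
    (hf.fderiv_right (m := 1) (by simpa [one_add_one_eq_two] using h2)).differentiableAt (by simp)
  have h : ∀ a b : E, (dir hs a (dir hs b f)).1 p =
      fderiv ℝ (fderiv ℝ (ext f)) p a b := fun a b => by
    rw [dir_apply hs a _ (F := fun q => fderiv ℝ (ext f) q b) (fun q => rfl),
      fderiv_clm_apply hd (differentiableAt_const b)]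
    simp
  rw [h, h]
  exact (hf.isSymmSndFDerivAt (by simpa using h2)) v w

end smoothOn

end SmoothFunctions

section Realization

variable {n : ℕ} {s : Set (Vec n × Vec n)}

/-- The phase algebra of smooth functions on an open subset of `ℝⁿ × ℝⁿ`. -/
def phase (hs : IsOpen s) : PhaseAlgebra n (smoothOn s) where
  X i := smoothOn.dir hs (Pi.single i 1, 0)
  Y i := smoothOn.dir hs (0, Pi.single i 1)
  y i := smoothOn.mk (fun p => p.2 i) (by fun_prop)
  X_X _ _ f := smoothOn.dir_comm hs _ _ f
  X_Y _ _ f := smoothOn.dir_comm hs _ _ f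
  Y_Y _ _ f := smoothOn.dir_comm hs _ _ f
  X_y i j := by
    refine Subtype.ext (funext fun p => ?_)
    rw [smoothOn.dir_apply hs _ _
      (F := (ContinuousLinearMap.proj (R := ℝ) (φ := fun _ : Fin n => ℝ) j).comp
        (ContinuousLinearMap.snd ℝ (Vec n) (Vec n))) (fun _ => rfl),
      ContinuousLinearMap.fderiv]
    simp
  Y_y i j := by
    refine Subtype.ext (funext fun p => ?_)
    rw [smoothOn.dir_apply hs _ _
      (F := (ContinuousLinearMap.proj (R := ℝ) (φ := fun _ : Fin n => ℝ) j).comp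
        (ContinuousLinearMap.snd ℝ (Vec n) (Vec n))) (fun _ => rfl),
      ContinuousLinearMap.fderiv]
    split_ifs with h
    · simp [h]
    · simp [Ne.symm h]

/-- `f` restricts to the element `F` of the algebra of smooth functions on `s`. -/
def Realizes (f : Vec n → Vec n → ℝ) (F : smoothOn s) : Prop :=
  ∀ p : s, f p.1.1 p.1.2 = F.1 p

theorem Realizes.pdx (hs : IsOpen s) {f : Vec n → Vec n → ℝ} {F : smoothOn s}
    (h : Realizes f F) (i : Fin n) : Realizes (pdx f i) ((phase hs).X i F) := by
  intro p
  have hd := smoothOn.differentiableAt hs F (F := fun q => f q.1 q.2) h p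
  have hc := hd.hasFDerivAt.comp (f := fun x => (x, p.1.2)) p.1.1 (hasFDerivAt_prodMk_left _ _)
  refine Eq.trans ?_ (smoothOn.dir_apply hs _ F (F := fun q => f q.1 q.2) h p).symm
  refine (congrArg (· (Pi.single i 1)) hc.fderiv).trans ?_
  simp

theorem Realizes.pdy (hs : IsOpen s) {f : Vec n → Vec n → ℝ} {F : smoothOn s}
    (h : Realizes f F) (i : Fin n) : Realizes (pdy f i) ((phase hs).Y i F) := by
  intro p
  have hd := smoothOn.differentiableAt hs F (F := fun q => f q.1 q.2) h p
  have hc := hd.hasFDerivAt.comp (f := fun y => (p.1.1, y)) p.1.2 (hasFDerivAt_prodMk_right _ _)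
  refine Eq.trans ?_ (smoothOn.dir_apply hs _ F (F := fun q => f q.1 q.2) h p).symm
  refine (congrArg (· (Pi.single i 1)) hc.fderiv).trans ?_
  simp

theorem smoothOn.sum_apply {ι : Type*} (t : Finset ι) (f : ι → smoothOn s) (p : s) :
    (∑ j ∈ t, f j).1 p = ∑ j ∈ t, (f j).1 p := by
  simp

theorem euler_of_homogeneous (hs : IsOpen s) {f : Vec n → Vec n → ℝ} {F : smoothOn s}
    (h : Realizes f F)
    (hf : ∀ p ∈ s, ∀ c : ℝ, 0 < c → f p.1 (c • p.2) = c ^ 2 * f p.1 p.2) :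
    (phase hs).euler F = 2 * F := by
  refine Subtype.ext (funext fun p => ?_)
  have hd := smoothOn.differentiableAt hs F (F := fun q => f q.1 q.2) h p
  have e : ((phase hs).euler F).1 p = fderiv ℝ (fun q => f q.1 q.2) p.1 (0, p.1.2) := by
    rw [PhaseAlgebra.euler_apply, smoothOn.sum_apply]
    have hv : ((0 : Vec n), p.1.2) = ∑ j, p.1.2 j • ((0 : Vec n), Pi.single j (1 : ℝ)) := by
      refine Prod.ext ?_ ?_
      · simp [Prod.fst_sum]
      · simp only [Prod.snd_sum, Prod.smul_snd]
        exact pi_eq_sum_univ' p.1.2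
    rw [hv, map_sum]
    refine Finset.sum_congr rfl fun j _ => ?_
    rw [map_smul, ← smoothOn.dir_apply hs _ F (F := fun q => f q.1 q.2) h p]
    rfl
  have hc : HasDerivAt (fun c : ℝ => (p.1.1, c • p.1.2)) ((0 : Vec n), p.1.2) 1 := by
    simpa using (hasDerivAt_const (1 : ℝ) p.1.1).prodMk
      ((hasDerivAt_id (1 : ℝ)).smul_const p.1.2)
  have h1 : HasDerivAt (fun c : ℝ => f p.1.1 (c • p.1.2))
      (fderiv ℝ (fun q => f q.1 q.2) p.1 (0, p.1.2)) 1 := by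
    refine HasFDerivAt.comp_hasDerivAt (x := (1 : ℝ)) (f := fun c : ℝ => (p.1.1, c • p.1.2))
      (l := fun q : Vec n × Vec n => f q.1 q.2) ?_ hc
    simpa using hd.hasFDerivAt
  have h2 : HasDerivAt (fun c : ℝ => f p.1.1 (c • p.1.2)) (2 * f p.1.1 p.1.2) 1 := by
    have h3 : HasDerivAt (fun c : ℝ => c ^ 2 * f p.1.1 p.1.2) (2 * f p.1.1 p.1.2) 1 := by
      simpa using (hasDerivAt_pow 2 (1 : ℝ)).mul_const (f p.1.1 p.1.2)
    refine h3.congr_of_eventuallyEq ?_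
    filter_upwards [lt_mem_nhds (zero_lt_one (α := ℝ))] with c hc
    exact hf p p.2 c hc
  rw [e, h1.unique h2, h p]
  rfl

variable (hs : IsOpen s) {G : Fin n → Vec n → Vec n → ℝ} {g : Fin n → smoothOn s}

theorem Realizes.riem (h : ∀ i, Realizes (G i) (g i)) (i k : Fin n) :
    Realizes (Riem G i k) ((phase hs).riem g i k) := by
  intro p
  have hX := fun k => (h i).pdx hs k p
  have hXY := fun j => (((h i).pdx hs j).pdy hs k) p
  have hYY := fun j => (((h i).pdy hs j).pdy hs k) p
  have hY := fun i k => (h i).pdy hs k p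
  simp only [Riem, Nc, Γc, hX, hXY, hYY, hY, fun j => h j p]
  simp only [PhaseAlgebra.riem, PhaseAlgebra.field_apply, (phase hs).X_Y, (phase hs).Y_Y _ k]
  have hy : ∀ j, ((phase hs).y j).1 p = p.1.2 j := fun _ => rfl
  have h2 : (2 : smoothOn s).1 p = 2 := rfl
  simp [hy, h2]
  ring

theorem Realizes.ric (h : ∀ i, Realizes (G i) (g i)) :
    Realizes (Ricci G) ((phase hs).ric g) := by
  intro p
  simp only [Ricci, fun m => Realizes.riem hs h m m p, PhaseAlgebra.ric]
  simp [div_eq_inv_mul]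

theorem Realizes.tcurv (h : ∀ i, Realizes (G i) (g i)) (i k : Fin n) :
    Realizes (Tcurv G i k) ((phase hs).tcurv g i k) := by
  intro p
  simp only [Tcurv, Realizes.riem hs h i k p, Realizes.ric hs h p,
    (Realizes.ric hs h).pdy hs k p, PhaseAlgebra.tcurv]
  have hy : ((phase hs).y i).1 p = p.1.2 i := rfl
  split_ifs <;> simp [hy, mul_assoc]

theorem isOpen_prod_slit {U : Set (Vec n)} (hU : IsOpen U) : IsOpen (U ×ˢ slit n) :=
  hU.prod isOpen_compl_singleton

end Realization

/-- Equations (2.18)–(2.19): the Weyl-type curvature of the projective spray `Ĝ` equals the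
Weyl curvature of `G`, `R̂^i_k - (R̂ δ^i_k - ½ R̂_{·k} y^i) = T^i_k + (3χ_k/(n+1)) y^i`;
in particular it is independent of the choice of the volume form. -/
theorem stmt_13 {n : ℕ} (hn : 2 ≤ n) (U : Set (Vec n)) (hU : IsOpen U) (hUne : U.Nonempty)
    (G : Fin n → Vec n → Vec n → ℝ) (hG : IsSpray U G)
    (σ : Vec n → ℝ) (hσ : IsVolumeForm U σ) :
    ∀ x ∈ U, ∀ y ∈ slit n, ∀ i k : Fin n,
      Riem (Ghat G σ) i k x y -
          (Ricci (Ghat G σ) x y * (if i = k then 1 else 0)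
            - (1/2) * pdy (Ricci (Ghat G σ)) k x y * y i) =
        Tcurv G i k x y + (3 * chiC G k x y / ((n : ℝ) + 1)) * y i := by
  intro x hx y hy i k
  have hs := isOpen_prod_slit hU
  have hn1 : (n : ℝ) - 1 ≠ 0 := by
    have : (2 : ℝ) ≤ n := by exact_mod_cast hn
    linarith
  let p : (U ×ˢ slit n : Set (Vec n × Vec n)) := ⟨(x, y), hx, hy⟩
  let g : Fin n → smoothOn (U ×ˢ slit n) := fun i => smoothOn.mk _ (hG.1 i)
  have hg : ∀ i, Realizes (G i) (g i) := fun i q => rfl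
  have hge : ∀ i, (phase hs).euler (g i) = 2 * g i := fun i =>
    euler_of_homogeneous hs (hg i) fun q hq c hc => hG.2 i q.1 hq.1 q.2 hq.2 c hc
  let L : smoothOn (U ×ˢ slit n) := smoothOn.mk (fun q => Real.log (σ q.1)) <|
    ContDiffOn.log (hσ.1.comp contDiffOn_fst fun q hq => hq.1) fun q hq => (hσ.2 q.1 hq.1).ne'
  have hL : Realizes (fun x _ => Real.log (σ x)) L := fun q => rfl
  have hYL : ∀ k, (phase hs).Y k L = 0 := fun k => Subtype.ext <| funext fun q => by
    rw [← hL.pdy hs k q]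
    simp [pdy]
  set P := (-((n : ℝ) + 1)⁻¹) • (∑ m, (phase hs).Y m (g m)
    - ∑ m, (phase hs).y m * (phase hs).X m L) with hP
  have hS : ∀ i, Realizes (Ghat G σ i) (g i + P * (phase hs).y i) := by
    intro i q
    have hX : ∀ m, fderiv ℝ (fun x' => Real.log (σ x')) q.1.1 (Pi.single m 1) =
      ((phase hs).X m L).1 q := fun m => hL.pdx hs m q
    have hY : ∀ m, Nc G m m q.1.1 q.1.2 = ((phase hs).Y m (g m)).1 q :=
      fun m => (hg m).pdy hs m q
    have hyy : ∀ m, ((phase hs).y m).1 q = q.1.2 m := fun m => rfl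
    simp only [Ghat, Scurv, hX, hY, hg i q]
    simp [hP, hyy]
    ring
  have h := (phase hs).tcurv_projective hn1 hge (fun m => (phase hs).X m L)
    (fun i k => by rw [← (phase hs).X_Y, hYL, map_zero]) (fun i k => (phase hs).X_X k i L) hP i k
  have hT := Realizes.tcurv hs hS i k p
  have hT' := fun m => Realizes.tcurv hs hg m k
  have hχ : chiC G k x y = -(1 / 3) * (∑ m, (phase hs).Y m ((phase hs).tcurv g m k)).1 p := by
    rw [smoothOn.sum_apply]
    exact congrArg _ (Finset.sum_congr rfl fun m _ => (hT' m).pdy hs m p)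
  have hyi : ((phase hs).y i).1 p = y i := rfl
  refine hT.trans ?_
  rw [h, hχ]
  refine (congrArg (· + _) (hT' i p).symm).trans ?_
  change _ + -((n : ℝ) + 1)⁻¹ * ((∑ m, (phase hs).Y m ((phase hs).tcurv g m k)).1 p *
    ((phase hs).y i).1 p) = _
  rw [hyi]
  ring

end BerwaldWeyl
end

section
/- Let G be a spray on a nonempty open set U ⊆ ℝ^n (n ≥ 2) and let dV = σ(x)dx and d̃V = σ̃(x)dx be volume forms on U related by σ = e^{(n+1)f} σ̃ for a smooth function f on U. Then the Berwald–Weyl curvatures W^o_k of (G,dV) and W̃^o_k of (G,d̃V) are related by W̃^o_k = W^o_k − W^m_k f_{x^m}, where W^i_k is the Weyl curvature of G. -/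
open scoped BigOperators
open MeasureTheory

noncomputable section BerwaldWeyl

/-- An algebra of functions of `(x, y)` with commuting coordinate derivations `X i = ∂/∂x^i`,
`Y i = ∂/∂y^i` and fibre coordinates `y i`. -/
structure CoordFrame (A : Type*) [CommRing A] [Algebra ℝ A] (n : ℕ) where
  X : Fin n → Derivation ℝ A A
  Y : Fin n → Derivation ℝ A A
  y : Fin n → A
  X_comm : ∀ i j a, X i (X j a) = X j (X i a)
  X_Y : ∀ i j a, X i (Y j a) = Y j (X i a)
  Y_comm : ∀ i j a, Y i (Y j a) = Y j (Y i a)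
  X_y : ∀ i j, X i (y j) = 0
  Y_y : ∀ i j, Y i (y j) = if j = i then 1 else 0

namespace CoordFrame

variable {A : Type*} [CommRing A] [Algebra ℝ A] {n : ℕ} (S : CoordFrame A n)

/-- The Euler field `y^j ∂/∂y^j`. -/
def euler : Derivation ℝ A A := ∑ j, S.y j • S.Y j

/-- The spray vector field `y^j ∂/∂x^j - 2 G^j ∂/∂y^j`. -/
def flow (G : Fin n → A) : Derivation ℝ A A :=
  ∑ j, S.y j • S.X j - (2 : A) • ∑ j, G j • S.Y j

/-- The Riemann curvature, with the spray field absorbing the two middle terms. -/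
def riem (G : Fin n → A) (i k : Fin n) : A :=
  2 * S.X k (G i) - S.flow G (S.Y k (G i)) - ∑ s, S.Y s (G i) * S.Y k (G s)

/-- The Ricci scalar. -/
def ricci (G : Fin n → A) : A :=
  algebraMap ℝ A ((n : ℝ) - 1)⁻¹ * ∑ m, S.riem G m m

/-- The curvature `T^i_k`. -/
def tcurv (G : Fin n → A) (i k : Fin n) : A :=
  S.riem G i k - (S.ricci G * (if i = k then 1 else 0)
    - algebraMap ℝ A (1 / 2) * S.Y k (S.ricci G) * S.y i)

/-- The χ-curvature. -/
def chi (G : Fin n → A) (i : Fin n) : A :=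
  algebraMap ℝ A (-(1 / 3)) * ∑ m, S.Y m (S.tcurv G m i)

/-- The Weyl curvature. -/
def weyl (G : Fin n → A) (i k : Fin n) : A :=
  S.tcurv G i k + algebraMap ℝ A (3 / ((n : ℝ) + 1)) * S.chi G k * S.y i

/-- The operator `F ↦ F_{|k} - ½ F_{·k|m} y^m`, simplified using the homogeneity of `G`. -/
def berwald (G : Fin n → A) (F : A) (k : Fin n) : A :=
  S.X k F - algebraMap ℝ A (1 / 2) * S.flow G (S.Y k F)
    - algebraMap ℝ A (1 / 2) * ∑ l, S.Y k (G l) * S.Y l F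

/-- `G` consists of elements homogeneous of degree two in `y`. -/
def IsHom2 (G : Fin n → A) : Prop := ∀ i, S.euler (G i) = 2 * G i

/-- `P = P_j(x) y^j` for a closed one-form `P_j dx^j`. -/
structure IsClosedForm (P : A) : Prop where
  Y_Y : ∀ i j, S.Y i (S.Y j P) = 0
  X_Y : ∀ i j, S.X i (S.Y j P) = S.X j (S.Y i P)
  euler : S.euler P = P

lemma derivation_sum_apply {ι : Type*} (s : Finset ι) (D : ι → Derivation ℝ A A) (a : A) :
    (∑ j ∈ s, D j) a = ∑ j ∈ s, D j a := by
  classical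
  induction s using Finset.induction_on with
  | empty => simp
  | insert j s hj ih => rw [Finset.sum_insert hj, Finset.sum_insert hj, Derivation.add_apply, ih]

lemma derivation_two (D : Derivation ℝ A A) : D 2 = 0 := by
  rw [← map_ofNat (algebraMap ℝ A) 2, D.map_algebraMap]

lemma euler_apply (a : A) : S.euler a = ∑ j, S.y j * S.Y j a := by
  simp [CoordFrame.euler, derivation_sum_apply]

lemma flow_apply (G : Fin n → A) (a : A) :
    S.flow G a = ∑ j, S.y j * S.X j a - 2 * ∑ j, G j * S.Y j a := by
  simp [flow, derivation_sum_apply]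

lemma derivation_const_mul (D : Derivation ℝ A A) (r : ℝ) (a : A) :
    D (algebraMap ℝ A r * a) = algebraMap ℝ A r * D a := by
  simp

lemma derivation_two_mul (D : Derivation ℝ A A) (a : A) : D (2 * a) = 2 * D a := by
  simp [two_mul]

lemma euler_Y (k : Fin n) (a : A) : S.euler (S.Y k a) = S.Y k (S.euler a) - S.Y k a := by
  simp only [euler_apply, map_sum, Derivation.leibniz, S.Y_y, smul_eq_mul, Finset.sum_add_distrib]
  simp [S.Y_comm k]

lemma euler_X (k : Fin n) (a : A) : S.euler (S.X k a) = S.X k (S.euler a) := by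
  simp [euler_apply, S.X_y, S.X_Y k]

lemma Y_flow (G : Fin n → A) (k : Fin n) (a : A) :
    S.Y k (S.flow G a) = S.flow G (S.Y k a) + S.X k a - 2 * ∑ j, S.Y k (G j) * S.Y j a := by
  simp only [flow_apply, map_sum, map_sub, derivation_two, mul_zero, add_zero, Derivation.leibniz,
    S.Y_y, smul_eq_mul, Finset.sum_add_distrib, S.Y_comm k, S.X_Y]
  simp only [mul_ite, mul_one, mul_zero, Finset.sum_ite_eq', Finset.mem_univ,
    if_true, mul_comm (S.Y _ a)]
  ring

lemma X_flow (G : Fin n → A) (k : Fin n) (a : A) :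
    S.X k (S.flow G a) = S.flow G (S.X k a) - 2 * ∑ j, S.X k (G j) * S.Y j a := by
  simp only [flow_apply, map_sum, map_sub, derivation_two, mul_zero, add_zero, Derivation.leibniz,
    S.X_y, smul_eq_mul, Finset.sum_add_distrib, S.X_comm k, S.X_Y,
    mul_comm (S.Y _ a)]
  ring

lemma flow_y (G : Fin n → A) (i : Fin n) : S.flow G (S.y i) = -2 * G i := by
  simp [flow_apply, S.X_y, S.Y_y]

lemma euler_y (i : Fin n) : S.euler (S.y i) = S.y i := by
  simp [euler_apply, S.Y_y]

lemma Y_sum_y_mul_X {a : A} (ha : ∀ i, S.Y i a = 0) (k : Fin n) :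
    S.Y k (∑ m, S.y m * S.X m a) = S.X k a := by
  simp [S.Y_y, ← S.X_Y, ha]

variable {S} {G : Fin n → A}

lemma IsHom2.sum_y_mul_Y (hG : S.IsHom2 G) (i : Fin n) :
    ∑ s, S.y s * S.Y s (G i) = 2 * G i := by
  rw [← euler_apply, hG i]

lemma IsHom2.euler_flow (hG : S.IsHom2 G) (a : A) :
    S.euler (S.flow G a) = S.flow G (S.euler a) + S.flow G a := by
  have hE (j : Fin n) : S.Y j (S.euler a) = S.euler (S.Y j a) + S.Y j a := by
    rw [euler_Y]; ring
  rw [S.flow_apply G a, S.flow_apply G (S.euler a)]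
  simp only [map_sub, derivation_two, mul_zero, add_zero, map_sum, Derivation.leibniz, smul_eq_mul,
    euler_y, hG _, hE, ← S.euler_X, mul_add, Finset.sum_add_distrib, Finset.mul_sum]
  have h1 : ∑ j, S.X j a * S.y j = ∑ j, S.y j * S.X j a :=
    Finset.sum_congr rfl fun _ _ => mul_comm _ _
  have h2 : ∑ j, 2 * (S.Y j a * (2 * G j)) = 2 * ∑ j, 2 * (G j * S.Y j a) := by
    rw [Finset.mul_sum]
    exact Finset.sum_congr rfl fun _ _ => by ring
  rw [h1, h2]
  ring

/-- Homogeneity of degree two of the Riemann curvature. -/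
lemma IsHom2.euler_riem (hG : S.IsHom2 G) (i k : Fin n) :
    S.euler (S.riem G i k) = 2 * S.riem G i k := by
  have hN (s j : Fin n) : S.euler (S.Y s (G j)) = S.Y s (G j) := by
    rw [euler_Y, hG, derivation_two_mul]; ring
  simp only [riem, map_sub, map_sum, derivation_two, mul_zero, add_zero, Derivation.leibniz,
    smul_eq_mul, S.euler_X, hG _, hG.euler_flow, hN]
  have h : ∑ s, (S.Y s (G i) * S.Y k (G s) + S.Y k (G s) * S.Y s (G i))
      = 2 * ∑ s, S.Y s (G i) * S.Y k (G s) := by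
    rw [Finset.mul_sum]
    exact Finset.sum_congr rfl fun _ _ => by ring
  rw [h]
  ring

lemma IsHom2.euler_ricci (hG : S.IsHom2 G) : S.euler (S.ricci G) = 2 * S.ricci G := by
  simp only [ricci, derivation_const_mul, map_sum, hG.euler_riem, ← Finset.mul_sum]
  ring

lemma IsHom2.add_mul_y (hG : S.IsHom2 G) {P : A} (hP : S.euler P = P) :
    S.IsHom2 fun i => G i + P * S.y i := by
  intro i
  simp only [map_add, Derivation.leibniz, smul_eq_mul, hG i, hP, euler_y]
  ring

lemma flow_add_mul_y (P a : A) :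
    S.flow (fun i => G i + P * S.y i) a = S.flow G a - 2 * P * S.euler a := by
  simp only [flow_apply, euler_apply, add_mul, Finset.sum_add_distrib, mul_assoc, ← Finset.mul_sum]
  ring

lemma Y_add_mul_y (P : A) (i k : Fin n) :
    S.Y k (G i + P * S.y i) = S.Y k (G i) + S.Y k P * S.y i + P * (if i = k then 1 else 0) := by
  simp only [map_add, Derivation.leibniz, smul_eq_mul, S.Y_y]
  ring

variable (S G) in
/-- The coefficient of `y^i` in the change of the Riemann curvature under `G ↦ G + P y`. -/
def riemShift (P : A) (k : Fin n) : A :=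
  2 * S.X k P - S.flow G (S.Y k P) - ∑ s, S.Y k (G s) * S.Y s P - P * S.Y k P

lemma IsHom2.riem_add_mul_y (hG : S.IsHom2 G) {P : A} (hP : S.euler P = P) (i k : Fin n) :
    S.riem (fun i => G i + P * S.y i) i k =
      S.riem G i k + (P ^ 2 - S.flow G P) * (if i = k then 1 else 0)
        + S.riemShift G P k * S.y i := by
  have hN : S.euler (S.Y k (G i)) = S.Y k (G i) := by
    rw [euler_Y, hG, derivation_two_mul]; ring
  have hPk : S.euler (S.Y k P) = 0 := by rw [euler_Y, hP, sub_self]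
  have hd (D : Derivation ℝ A A) : D (if i = k then (1 : A) else 0) = 0 := by split_ifs <;> simp
  have hsum : ∑ s, (S.Y s (G i) + S.Y s P * S.y i + P * (if i = s then 1 else 0)) *
      (S.Y k (G s) + S.Y k P * S.y s + P * (if s = k then 1 else 0)) =
      ∑ s, S.Y s (G i) * S.Y k (G s) + S.Y k P * (2 * G i) + 2 * P * S.Y k (G i)
        + S.y i * ∑ s, S.Y k (G s) * S.Y s P + 3 * P * S.Y k P * S.y i
        + P ^ 2 * (if i = k then 1 else 0) := by
    have h (s : Fin n) : (S.Y s (G i) + S.Y s P * S.y i + P * (if i = s then 1 else 0)) *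
      (S.Y k (G s) + S.Y k P * S.y s + P * (if s = k then 1 else 0)) =
      S.Y s (G i) * S.Y k (G s) + S.Y k P * (S.y s * S.Y s (G i))
        + P * (S.Y s (G i) * if s = k then 1 else 0)
        + S.y i * (S.Y k (G s) * S.Y s P) + (S.Y k P * S.y i) * (S.y s * S.Y s P)
        + (P * S.y i) * (S.Y s P * if s = k then 1 else 0)
        + P * ((if i = s then 1 else 0) * S.Y k (G s))
        + (P * S.Y k P) * ((if i = s then 1 else 0) * S.y s)
        + P ^ 2 * ((if i = s then 1 else 0) * (if s = k then 1 else 0)) := by ring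
    simp only [h, Finset.sum_add_distrib, ← Finset.mul_sum, hG.sum_y_mul_Y, ← euler_apply, hP]
    simp only [mul_ite, mul_one, mul_zero, ite_mul, one_mul, zero_mul, Finset.sum_ite_eq,
      Finset.sum_ite_eq', Finset.mem_univ, if_true]
    ring
  simp only [riem, riemShift, flow_add_mul_y, Y_add_mul_y, hsum]
  simp only [map_add, Derivation.leibniz, smul_eq_mul, hd, hN, hPk, flow_y, euler_y, hP, S.X_y]
  ring

lemma sum_y_mul_riemShift {P : A} (hG : S.IsHom2 G) (hP : S.euler P = P) :
    ∑ k, S.y k * S.riemShift G P k = -(P ^ 2 - S.flow G P) := by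
  have h1 : ∑ k, S.y k * S.flow G (S.Y k P) = S.flow G P + 2 * ∑ k, G k * S.Y k P := by
    nth_rewrite 2 [← hP]
    rw [euler_apply]
    simp only [map_sum, Derivation.leibniz, smul_eq_mul, flow_y, Finset.sum_add_distrib,
      Finset.mul_sum]
    rw [add_assoc, ← Finset.sum_add_distrib]
    simp only [left_eq_add]
    exact Finset.sum_eq_zero fun _ _ => by ring
  have h2 : ∑ k, S.y k * ∑ s, S.Y k (G s) * S.Y s P = 2 * ∑ s, G s * S.Y s P := by
    simp only [Finset.mul_sum]
    rw [Finset.sum_comm]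
    refine Finset.sum_congr rfl fun s _ => ?_
    simp only [← mul_assoc]
    rw [← Finset.sum_mul, hG.sum_y_mul_Y]
  have h3 : ∑ k, S.y k * (P * S.Y k P) = P ^ 2 := by
    simp only [mul_left_comm _ P, ← Finset.mul_sum, ← euler_apply, hP, sq]
  have h4 : ∑ k, S.y k * (2 * S.X k P) = 2 * ∑ k, S.y k * S.X k P := by
    simp only [mul_left_comm _ (2 : A), ← Finset.mul_sum]
  simp only [riemShift, mul_sub, Finset.sum_sub_distrib, h1, h2, h3, h4]
  linear_combination -2 * S.flow_apply G P

lemma two_mul_algebraMap_half : 2 * algebraMap ℝ A (1 / 2) = 1 := by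
  rw [← map_ofNat (algebraMap ℝ A) 2, ← map_mul]; norm_num

lemma mul_algebraMap_inv_sub_one (hn : 2 ≤ n) :
    ((n : A) - 1) * algebraMap ℝ A ((n : ℝ) - 1)⁻¹ = 1 := by
  have h : (2 : ℝ) ≤ n := by exact_mod_cast hn
  have h' : (n : ℝ) - 1 ≠ 0 := by linarith
  rw [← map_natCast (algebraMap ℝ A) n, ← map_one (algebraMap ℝ A), ← map_sub, ← map_mul,
    mul_inv_cancel₀ h']

lemma IsHom2.ricci_add_mul_y (hn : 2 ≤ n) (hG : S.IsHom2 G) {P : A} (hP : S.euler P = P) :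
    S.ricci (fun i => G i + P * S.y i) = S.ricci G + (P ^ 2 - S.flow G P) := by
  have hs : ∑ m, S.riemShift G P m * S.y m = -(P ^ 2 - S.flow G P) := by
    simpa only [mul_comm] using sum_y_mul_riemShift hG hP
  simp only [ricci, hG.riem_add_mul_y hP, Finset.sum_add_distrib, if_true, mul_one,
    Finset.sum_const, Finset.card_univ, Fintype.card_fin, nsmul_eq_mul, hs]
  linear_combination (P ^ 2 - S.flow G P) * mul_algebraMap_inv_sub_one (A := A) hn

variable (S G) in
/-- The coefficient of `y^i` in the change of `T^i_k` under `G ↦ G + P y`. -/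
def tcurvShift (P : A) (k : Fin n) : A :=
  S.riemShift G P k + algebraMap ℝ A (1 / 2) * S.Y k (P ^ 2 - S.flow G P)

lemma IsHom2.tcurv_add_mul_y (hn : 2 ≤ n) (hG : S.IsHom2 G) {P : A} (hP : S.euler P = P)
    (i k : Fin n) :
    S.tcurv (fun i => G i + P * S.y i) i k = S.tcurv G i k + S.tcurvShift G P k * S.y i := by
  simp only [tcurv, tcurvShift, hG.riem_add_mul_y hP, hG.ricci_add_mul_y hn hP, map_add]
  ring

lemma IsHom2.euler_tcurvShift (hG : S.IsHom2 G) {P : A} (hP : S.euler P = P) (k : Fin n) :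
    S.euler (S.tcurvShift G P k) = S.tcurvShift G P k := by
  have hPk (k : Fin n) : S.euler (S.Y k P) = 0 := by rw [euler_Y, hP, sub_self]
  have hN (i : Fin n) : S.euler (S.Y k (G i)) = S.Y k (G i) := by
    rw [euler_Y, hG, derivation_two_mul]; ring
  simp only [tcurvShift, riemShift, map_add, map_sub, derivation_two, mul_zero, add_zero,
    Derivation.map_algebraMap, map_sum, Derivation.leibniz, smul_eq_mul, euler_X, euler_Y, hP,
    hG.euler_flow, sq, hN,
    hPk, map_zero]
  simp only [zero_add, mul_comm (S.Y k (G _))]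
  ring

lemma sum_Y_mul_y {a : A} : ∑ m, S.Y m (a * S.y m) = S.euler a + n * a := by
  simp only [Derivation.leibniz, smul_eq_mul, S.Y_y, if_true, mul_one, Finset.sum_add_distrib,
    Finset.sum_const, Finset.card_univ, Fintype.card_fin, nsmul_eq_mul, euler_apply]
  ring

/-- The Weyl curvature is a projective invariant. -/
lemma IsHom2.weyl_add_mul_y (hn : 2 ≤ n) (hG : S.IsHom2 G) {P : A} (hP : S.euler P = P)
    (i k : Fin n) :
    S.weyl (fun i => G i + P * S.y i) i k = S.weyl G i k := by
  have hc : algebraMap ℝ A (3 / ((n : ℝ) + 1)) * algebraMap ℝ A (-(1 / 3)) * ((n : A) + 1) =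
      -1 := by
    have : (n : ℝ) + 1 ≠ 0 := by positivity
    rw [← map_natCast (algebraMap ℝ A) n, ← map_one (algebraMap ℝ A), ← map_add, ← map_mul,
      ← map_mul, ← map_neg]
    congr 1
    field_simp
  simp only [weyl, chi, hG.tcurv_add_mul_y hn hP, map_add, Finset.sum_add_distrib, sum_Y_mul_y,
    hG.euler_tcurvShift hP]
  linear_combination S.tcurvShift G P k * S.y i * hc

lemma IsClosedForm.flow_Y {P : A} (hP : S.IsClosedForm P) (k : Fin n) :
    S.flow G (S.Y k P) = S.X k P := by
  conv_rhs => rw [← hP.euler, euler_apply]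
  simp [flow_apply, S.X_y, hP.Y_Y, hP.X_Y _ k]

/-- A spray whose divergence `∂G^m/∂y^m` is a closed one-form has vanishing χ-curvature. -/
lemma IsHom2.chi_eq_zero (hn : 2 ≤ n) (hG : S.IsHom2 G)
    (hN : S.IsClosedForm (∑ m, S.Y m (G m))) (i : Fin n) : S.chi G i = 0 := by
  have hER : S.euler (S.Y i (S.ricci G)) = S.Y i (S.ricci G) := by
    rw [euler_Y, hG.euler_ricci, derivation_two_mul]; ring
  have htrace : ((n : A) - 1) * S.Y i (S.ricci G) = ∑ m, S.Y i (S.riem G m m) := by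
    rw [ricci, derivation_const_mul, map_sum]
    linear_combination (∑ m, S.Y i (S.riem G m m)) * mul_algebraMap_inv_sub_one (A := A) hn
  have hT : ∑ m, S.Y m (S.tcurv G m i) =
      ∑ m, S.Y m (S.riem G m i) + algebraMap ℝ A (1 / 2) * ∑ m, S.Y i (S.riem G m m) := by
    have hd (m : Fin n) : S.Y m (S.ricci G * if m = i then 1 else 0) =
        if m = i then S.Y i (S.ricci G) else 0 := by split_ifs with h <;> simp [h]
    simp only [tcurv, map_sub, Finset.sum_sub_distrib, hd, sum_Y_mul_y, derivation_const_mul, hER,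
      Finset.sum_ite_eq', Finset.mem_univ, if_true, ← htrace]
    linear_combination S.Y i (S.ricci G) * two_mul_algebraMap_half (A := A)
  have hflow := hN.flow_Y (G := G) i
  have hdouble : ∑ m, ∑ s, S.Y m (G s) * S.Y s (S.Y i (G m)) =
      ∑ m, ∑ s, S.Y s (G m) * S.Y m (S.Y i (G s)) := Finset.sum_comm
  have hmix : ∑ m, ∑ s, S.Y i (G s) * S.Y m (S.Y s (G m)) =
      ∑ s, S.Y s (∑ m, S.Y m (G m)) * S.Y i (G s) := by
    rw [Finset.sum_comm]
    simp only [map_sum, Finset.mul_sum, S.Y_comm _ _ (G _), mul_comm]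
  have h1 : ∑ m, S.Y m (S.riem G m i) = S.X i (∑ m, S.Y m (G m)) - ∑ m, S.X m (S.Y i (G m))
      + ∑ m, ∑ s, S.Y s (G m) * S.Y m (S.Y i (G s))
      - ∑ s, S.Y s (∑ m, S.Y m (G m)) * S.Y i (G s) := by
    have hfl : ∑ m, S.flow G (S.Y m (S.Y i (G m))) = S.X i (∑ m, S.Y m (G m)) := by
      rw [← hflow, map_sum, map_sum]
      exact Finset.sum_congr rfl fun m _ => by rw [S.Y_comm m i]
    simp only [riem, map_sub, derivation_two, mul_zero, add_zero, map_sum (S.Y _),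
      Derivation.leibniz, smul_eq_mul, Y_flow, Finset.sum_sub_distrib, Finset.sum_add_distrib,
      ← Finset.mul_sum, hfl, hmix, hdouble,
      ← S.X_Y i]
    simp only [← map_sum (S.X i)]
    ring
  have h2 : ∑ m, S.Y i (S.riem G m m) = 2 * ∑ m, S.X m (S.Y i (G m))
      - 2 * S.X i (∑ m, S.Y m (G m))
      + 2 * ∑ s, S.Y s (∑ m, S.Y m (G m)) * S.Y i (G s)
      - 2 * ∑ m, ∑ s, S.Y s (G m) * S.Y m (S.Y i (G s)) := by
    have hfl : ∑ m, S.Y i (S.flow G (S.Y m (G m))) = 2 * S.X i (∑ m, S.Y m (G m))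
        - 2 * ∑ s, S.Y s (∑ m, S.Y m (G m)) * S.Y i (G s) := by
      rw [← map_sum, ← map_sum, Y_flow, hflow]
      simp only [mul_comm (S.Y i (G _))]
      ring
    simp only [riem, map_sub, derivation_two, mul_zero, add_zero, Derivation.leibniz, smul_eq_mul,
      Finset.sum_sub_distrib, ← Finset.mul_sum, hfl, ← S.X_Y _ i]
    simp only [map_sum (S.Y i), Derivation.leibniz, smul_eq_mul, Finset.sum_add_distrib,
      S.Y_comm i, hdouble]
    ring
  rw [chi, hT, h1, h2]
  linear_combination (algebraMap ℝ A (-(1 / 3))) * (∑ m, S.X m (S.Y i (G m))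
      - S.X i (∑ m, S.Y m (G m))
      + ∑ s, S.Y s (∑ m, S.Y m (G m)) * S.Y i (G s)
      - ∑ m, ∑ s, S.Y s (G m) * S.Y m (S.Y i (G s))) * two_mul_algebraMap_half (A := A)

lemma berwald_add_mul_y (P : A) {F : A} (hF : S.euler F = 2 * F) (k : Fin n) :
    S.berwald (fun i => G i + P * S.y i) F k =
      S.berwald G F k + algebraMap ℝ A (1 / 2) * P * S.Y k F - S.Y k P * F := by
  have hFk : S.euler (S.Y k F) = S.Y k F := by
    rw [euler_Y, hF, derivation_two_mul]; ring
  have hsum : ∑ l, S.Y k (G l + P * S.y l) * S.Y l F =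
      ∑ l, S.Y k (G l) * S.Y l F + S.Y k P * (2 * F) + P * S.Y k F := by
    simp only [Y_add_mul_y, add_mul, Finset.sum_add_distrib, mul_assoc, ← Finset.mul_sum,
      ← euler_apply, hF, ite_mul, one_mul, zero_mul, Finset.sum_ite_eq', Finset.mem_univ, if_true]
  rw [berwald, berwald, hsum, flow_add_mul_y, hFk]
  linear_combination (-(S.Y k P * F)) * two_mul_algebraMap_half (A := A)

lemma berwald_sq_sub_flow {P : A} (hP : S.IsClosedForm P) (k : Fin n) :
    S.berwald G (P ^ 2 - S.flow G P) k =
      P * S.X k P - S.flow G P * S.Y k P - P * ∑ l, S.Y k (G l) * S.Y l P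
        + ∑ m, S.riem G m k * S.Y m P := by
  have hY (l : Fin n) : S.Y l (P ^ 2 - S.flow G P) =
      2 * P * S.Y l P - 2 * S.X l P + 2 * ∑ m, S.Y l (G m) * S.Y m P := by
    rw [map_sub, Y_flow, hP.flow_Y, sq, Derivation.leibniz, smul_eq_mul]
    ring
  have hX : S.X k (P ^ 2 - S.flow G P) =
      2 * P * S.X k P - S.flow G (S.X k P) + 2 * ∑ m, S.X k (G m) * S.Y m P := by
    rw [map_sub, X_flow, sq, Derivation.leibniz, smul_eq_mul]
    ring
  have hD : S.flow G (S.Y k (P ^ 2 - S.flow G P)) =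
      2 * S.flow G P * S.Y k P + 2 * P * S.X k P - 2 * S.flow G (S.X k P)
        + 2 * ∑ m, S.flow G (S.Y k (G m)) * S.Y m P + 2 * ∑ m, S.Y k (G m) * S.X m P := by
    simp only [hY, map_add, map_sub, map_sum, Derivation.leibniz, smul_eq_mul, derivation_two,
      hP.flow_Y, Finset.sum_add_distrib, mul_comm (S.Y _ P)]
    ring
  have hYY : ∑ l, S.Y k (G l) * S.Y l (P ^ 2 - S.flow G P) =
      2 * P * ∑ l, S.Y k (G l) * S.Y l P - 2 * ∑ l, S.Y k (G l) * S.X l P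
        + 2 * ∑ m, (∑ s, S.Y s (G m) * S.Y k (G s)) * S.Y m P := by
    have hswap : ∑ m, (∑ s, S.Y s (G m) * S.Y k (G s)) * S.Y m P =
        ∑ l, S.Y k (G l) * ∑ m, S.Y l (G m) * S.Y m P := by
      simp only [Finset.sum_mul, Finset.mul_sum]
      rw [Finset.sum_comm]
      exact Finset.sum_congr rfl fun _ _ => Finset.sum_congr rfl fun _ _ => by ring
    have hterm (l : Fin n) : S.Y k (G l) * S.Y l (P ^ 2 - S.flow G P) =
        2 * P * (S.Y k (G l) * S.Y l P) - 2 * (S.Y k (G l) * S.X l P)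
          + 2 * (S.Y k (G l) * ∑ m, S.Y l (G m) * S.Y m P) := by
      rw [hY]; ring
    simp only [hterm, hswap, Finset.sum_add_distrib, Finset.sum_sub_distrib, ← Finset.mul_sum]
  have hR : ∑ m, S.riem G m k * S.Y m P = 2 * ∑ m, S.X k (G m) * S.Y m P
      - ∑ m, S.flow G (S.Y k (G m)) * S.Y m P
      - ∑ m, (∑ s, S.Y s (G m) * S.Y k (G s)) * S.Y m P := by
    simp only [riem, sub_mul, Finset.sum_sub_distrib, mul_assoc, ← Finset.mul_sum]
  rw [berwald, hX, hD, hYY, hR]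
  linear_combination (-S.flow G P * S.Y k P - P * S.X k P + S.flow G (S.X k P)
    - ∑ m, S.flow G (S.Y k (G m)) * S.Y m P - P * ∑ l, S.Y k (G l) * S.Y l P
    - ∑ m, (∑ s, S.Y s (G m) * S.Y k (G s)) * S.Y m P) * two_mul_algebraMap_half (A := A)

/-- Change of the Berwald–Weyl curvature under `G ↦ G + P y` for a closed form `P`. -/
lemma IsHom2.berwald_ricci_add_mul_y (hn : 2 ≤ n) (hG : S.IsHom2 G) {P : A}
    (hP : S.IsClosedForm P) (k : Fin n) :
    S.berwald (fun i => G i + P * S.y i) (S.ricci (fun i => G i + P * S.y i)) k =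
      S.berwald G (S.ricci G) k + ∑ m, S.tcurv G m k * S.Y m P := by
  have hT : ∑ m, S.tcurv G m k * S.Y m P = ∑ m, S.riem G m k * S.Y m P - S.ricci G * S.Y k P
      + algebraMap ℝ A (1 / 2) * S.Y k (S.ricci G) * P := by
    simp only [tcurv, sub_mul, Finset.sum_sub_distrib, mul_assoc, ← Finset.mul_sum, ← euler_apply,
      hP.euler, ite_mul, one_mul, zero_mul, Finset.sum_ite_eq', Finset.mem_univ, if_true]
    ring
  have hY : S.Y k (P ^ 2 - S.flow G P) =
      2 * P * S.Y k P - 2 * S.X k P + 2 * ∑ m, S.Y k (G m) * S.Y m P := by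
    rw [map_sub, Y_flow, hP.flow_Y, sq, Derivation.leibniz, smul_eq_mul]
    ring
  have hadd : S.berwald G (S.ricci G + (P ^ 2 - S.flow G P)) k =
      S.berwald G (S.ricci G) k + S.berwald G (P ^ 2 - S.flow G P) k := by
    simp only [berwald, map_add, mul_add, Finset.sum_add_distrib]
    ring
  have hE := (hG.add_mul_y hP.euler).euler_ricci
  rw [hG.ricci_add_mul_y hn hP.euler] at hE ⊢
  rw [berwald_add_mul_y P hE, hadd, berwald_sq_sub_flow hP, hT, map_add, hY]
  linear_combination (P ^ 2 * S.Y k P - P * S.X k P + P * ∑ m, S.Y k (G m) * S.Y m P)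
    * two_mul_algebraMap_half (A := A)

lemma isClosedForm_sum_y_mul_X {a : A} (ha : ∀ i, S.Y i a = 0) :
    S.IsClosedForm (∑ m, S.y m * S.X m a) := by
  have h := S.Y_sum_y_mul_X ha
  refine ⟨fun i j => ?_, fun i j => ?_, ?_⟩
  · rw [h, ← S.X_Y, ha, map_zero]
  · rw [h, h, S.X_comm]
  · simp only [euler_apply, h]

lemma IsClosedForm.neg {P : A} (hP : S.IsClosedForm P) : S.IsClosedForm (-P) :=
  ⟨fun i j => by simp [hP.Y_Y], fun i j => by simp [hP.X_Y i j], by simp [hP.euler]⟩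

variable (S G) in
lemma riem_eq (i k : Fin n) :
    2 * S.X k (G i) - ∑ j, S.y j * S.Y k (S.X j (G i)) + 2 * ∑ j, G j * S.Y k (S.Y j (G i))
      - ∑ s, S.Y s (G i) * S.Y k (G s) = S.riem G i k := by
  simp only [riem, flow_apply, S.X_Y, S.Y_comm k]
  ring

lemma IsHom2.berwald_eq (hG : S.IsHom2 G) (F : A) (k : Fin n) :
    S.X k F - ∑ l, S.Y k (G l) * S.Y l F
      - algebraMap ℝ A (1 / 2) * ∑ m, (S.X m (S.Y k F) - ∑ l, S.Y m (G l) * S.Y l (S.Y k F)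
        - ∑ l, S.Y l F * S.Y m (S.Y k (G l))) * S.y m = S.berwald G F k := by
  have hN (l : Fin n) : S.euler (S.Y k (G l)) = S.Y k (G l) := by
    rw [euler_Y, hG, derivation_two_mul]; ring
  have h1 : ∑ m, (∑ l, S.Y m (G l) * S.Y l (S.Y k F)) * S.y m =
      2 * ∑ l, G l * S.Y l (S.Y k F) := by
    simp only [Finset.sum_mul, Finset.mul_sum]
    rw [Finset.sum_comm]
    refine Finset.sum_congr rfl fun l _ => ?_
    rw [← mul_assoc, ← hG.sum_y_mul_Y, Finset.sum_mul]
    exact Finset.sum_congr rfl fun _ _ => by ring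
  have h2 : ∑ m, (∑ l, S.Y l F * S.Y m (S.Y k (G l))) * S.y m =
      ∑ l, S.Y k (G l) * S.Y l F := by
    simp only [Finset.sum_mul]
    rw [Finset.sum_comm]
    refine Finset.sum_congr rfl fun l _ => ?_
    rw [← hN l, euler_apply, Finset.sum_mul]
    exact Finset.sum_congr rfl fun _ _ => by rw [← euler_apply, hN]; ring
  have h3 : ∑ m, S.X m (S.Y k F) * S.y m = ∑ m, S.y m * S.X m (S.Y k F) := by
    simp only [mul_comm]
  simp only [sub_mul, Finset.sum_sub_distrib, h1, h2, h3, berwald, flow_apply]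
  linear_combination (∑ l, S.Y k (G l) * S.Y l F) * two_mul_algebraMap_half (A := A)

variable (S G) in
/-- The projective factor `-S/(n+1)` of the spray `G` for the volume form with logarithmic
density `a`. -/
def projFactor (a : A) : A :=
  -(algebraMap ℝ A ((n : ℝ) + 1)⁻¹ * (∑ m, S.Y m (G m) - ∑ m, S.y m * S.X m a))

variable (S G) in
lemma add_projFactor_mul_y (a : A) (i : Fin n) :
    G i + S.projFactor G a * S.y i = G i -
      algebraMap ℝ A ((n : ℝ) + 1)⁻¹ * (∑ m, S.Y m (G m) - ∑ m, S.y m * S.X m a) * S.y i := by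
  rw [projFactor]
  ring

variable (A n) in
lemma add_one_mul_algebraMap_inv :
    ((n : A) + 1) * algebraMap ℝ A ((n : ℝ) + 1)⁻¹ = 1 := by
  have h : (n : ℝ) + 1 ≠ 0 := by positivity
  rw [← map_natCast (algebraMap ℝ A) n, ← map_one (algebraMap ℝ A), ← map_add, ← map_mul,
    mul_inv_cancel₀ h]

lemma IsHom2.euler_projFactor (hG : S.IsHom2 G) {a : A} (ha : ∀ i, S.Y i a = 0) :
    S.euler (S.projFactor G a) = S.projFactor G a := by
  have hN (m : Fin n) : S.euler (S.Y m (G m)) = S.Y m (G m) := by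
    rw [euler_Y, hG, derivation_two_mul]; ring
  rw [projFactor, map_neg, derivation_const_mul, map_sub, (isClosedForm_sum_y_mul_X ha).euler,
    map_sum]
  simp only [hN]

/-- The projective spray of a volume form has a closed divergence, so `T` is its Weyl curvature. -/
lemma IsHom2.tcurv_projective (hn : 2 ≤ n) (hG : S.IsHom2 G) {a : A} (ha : ∀ i, S.Y i a = 0)
    (i k : Fin n) :
    S.tcurv (fun i => G i + S.projFactor G a * S.y i) i k = S.weyl G i k := by
  have hP := hG.euler_projFactor ha
  have hdiv : ∑ m, S.Y m (G m + S.projFactor G a * S.y m) = ∑ m, S.y m * S.X m a := by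
    simp only [map_add, Finset.sum_add_distrib]
    rw [sum_Y_mul_y, hP, projFactor]
    linear_combination (-(∑ m, S.Y m (G m) - ∑ m, S.y m * S.X m a)) *
      add_one_mul_algebraMap_inv A n
  rw [← hG.weyl_add_mul_y hn hP, weyl, (hG.add_mul_y hP).chi_eq_zero hn
    (by rw [hdiv]; exact isClosedForm_sum_y_mul_X ha)]
  ring

/-- Dependence of the Berwald–Weyl curvature on the volume form. -/
theorem IsHom2.berwald_projective (hn : 2 ≤ n) (hG : S.IsHom2 G) {a b f : A}
    (ha : ∀ i, S.Y i a = 0) (hf : ∀ i, S.Y i f = 0)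
    (hab : a = algebraMap ℝ A ((n : ℝ) + 1) * f + b) (k : Fin n) :
    S.berwald (fun i => G i + S.projFactor G b * S.y i)
        (S.ricci fun i => G i + S.projFactor G b * S.y i) k =
      S.berwald (fun i => G i + S.projFactor G a * S.y i)
        (S.ricci fun i => G i + S.projFactor G a * S.y i) k - ∑ m, S.weyl G m k * S.X m f := by
  have hfac : S.projFactor G b = S.projFactor G a + -∑ m, S.y m * S.X m f := by
    have hX (m : Fin n) : S.y m * S.X m a =
        ((n : A) + 1) * (S.y m * S.X m f) + S.y m * S.X m b := by
      rw [hab, map_add, derivation_const_mul, map_add, map_natCast, map_one]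
      ring
    simp only [projFactor, hX, Finset.sum_add_distrib, ← Finset.mul_sum]
    linear_combination (-∑ m, S.y m * S.X m f) * add_one_mul_algebraMap_inv A n
  have hspray : (fun i => G i + S.projFactor G b * S.y i) = fun i =>
      (G i + S.projFactor G a * S.y i) + (-∑ m, S.y m * S.X m f) * S.y i := by
    funext i
    rw [hfac]
    ring
  rw [hspray, (hG.add_mul_y (hG.euler_projFactor ha)).berwald_ricci_add_mul_y hn
    (isClosedForm_sum_y_mul_X hf).neg k]
  simp only [hG.tcurv_projective hn ha, map_neg, S.Y_sum_y_mul_X hf, mul_neg,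
    Finset.sum_neg_distrib, sub_eq_add_neg]

end CoordFrame

section SmoothFunctions

lemma extend_val_apply {E : Type*} {Ω : Set E} (g : Ω → ℝ) {p : E} (hp : p ∈ Ω) :
    Function.extend Subtype.val g 0 p = g ⟨p, hp⟩ :=
  Subtype.val_injective.extend_apply g 0 ⟨p, hp⟩

variable {E : Type*} [NormedAddCommGroup E] [NormedSpace ℝ E] {Ω : Set E}

/-- The algebra of smooth real functions on a subset `Ω` of a normed space. -/
def smoothFun (Ω : Set E) : Subalgebra ℝ (Ω → ℝ) where
  carrier := {g | ContDiffOn ℝ (⊤ : ℕ∞) (Function.extend Subtype.val g 0) Ω}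
  mul_mem' {g h} hg hh := (hg.mul hh).congr fun p hp => by simp [extend_val_apply _ hp]
  add_mem' {g h} hg hh := (hg.add hh).congr fun p hp => by simp [extend_val_apply _ hp]
  algebraMap_mem' r := (contDiffOn_const (c := r)).congr fun p hp => by
    simp [extend_val_apply _ hp]

/-- The extension by zero of an element of `smoothFun Ω`. -/
def smoothFun.ext0 (g : smoothFun Ω) : E → ℝ := Function.extend Subtype.val g.1 0

lemma smoothFun.ext0_apply (g : smoothFun Ω) (p : Ω) : ext0 g p = g.1 p :=
  extend_val_apply g.1 p.2

lemma smoothFun.contDiffOn (g : smoothFun Ω) : ContDiffOn ℝ (⊤ : ℕ∞) (ext0 g) Ω := g.2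

/-- The restriction to `Ω` of a function which is smooth on `Ω`. -/
def smoothFun.mk (F : E → ℝ) (hF : ContDiffOn ℝ (⊤ : ℕ∞) F Ω) : smoothFun Ω :=
  ⟨fun p => F p, hF.congr fun p hp => by simp [extend_val_apply _ hp]⟩

lemma smoothFun.contDiffAt (hΩ : IsOpen Ω) (g : smoothFun Ω) (p : Ω) :
    ContDiffAt ℝ (⊤ : ℕ∞) (ext0 g) p :=
  (contDiffOn g).contDiffAt (hΩ.mem_nhds p.2)

lemma smoothFun.differentiableAt (hΩ : IsOpen Ω) (g : smoothFun Ω) (p : Ω) :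
    DifferentiableAt ℝ (ext0 g) p :=
  (contDiffAt hΩ g p).differentiableAt (by simp)

lemma smoothFun.eventuallyEq_ext0 (hΩ : IsOpen Ω) (g : smoothFun Ω) {F : E → ℝ}
    (h : ∀ p : Ω, F p = g.1 p) (p : Ω) : F =ᶠ[nhds p.1] ext0 g := by
  filter_upwards [hΩ.mem_nhds p.2] with q hq
  rw [h ⟨q, hq⟩, ← ext0_apply g ⟨q, hq⟩]

/-- The derivation of `smoothFun Ω` along a constant vector field. -/
def smoothFun.dir (hΩ : IsOpen Ω) (v : E) : Derivation ℝ (smoothFun Ω) (smoothFun Ω) :=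
  Derivation.mk'
    { toFun := fun g => mk (fun p => fderiv ℝ (ext0 g) p v)
        (((contDiffOn g).fderiv_of_isOpen hΩ (by simp)).clm_apply contDiffOn_const)
      map_add' := fun g h => by
        ext p
        have := (eventuallyEq_ext0 hΩ (g + h) (F := ext0 g + ext0 h)
          (fun q => by simp [ext0_apply]) p).fderiv_eq (𝕜 := ℝ)
        change fderiv ℝ (ext0 (g + h)) p v = fderiv ℝ (ext0 g) p v + fderiv ℝ (ext0 h) p v
        rw [← this, fderiv_add (differentiableAt hΩ g p) (differentiableAt hΩ h p)]
        rfl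
      map_smul' := fun r g => by
        ext p
        have := (eventuallyEq_ext0 hΩ (r • g) (F := r • ext0 g)
          (fun q => by simp [ext0_apply]) p).fderiv_eq (𝕜 := ℝ)
        change fderiv ℝ (ext0 (r • g)) p v = r • fderiv ℝ (ext0 g) p v
        rw [← this, fderiv_const_smul (differentiableAt hΩ g p)]
        rfl }
    fun g h => by
      ext p
      have := (eventuallyEq_ext0 hΩ (g * h) (F := ext0 g * ext0 h)
        (fun q => by simp [ext0_apply]) p).fderiv_eq (𝕜 := ℝ)
      change fderiv ℝ (ext0 (g * h)) p v =
        g.1 p * fderiv ℝ (ext0 h) p v + h.1 p * fderiv ℝ (ext0 g) p v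
      rw [← this, fderiv_mul (differentiableAt hΩ g p) (differentiableAt hΩ h p)]
      simp [ext0_apply]

lemma smoothFun.dir_apply (hΩ : IsOpen Ω) (v : E) (g : smoothFun Ω) {F : E → ℝ}
    (h : ∀ p : Ω, F p = g.1 p) (p : Ω) : (dir hΩ v g).1 p = fderiv ℝ F p v := by
  rw [(eventuallyEq_ext0 hΩ g h p).fderiv_eq]
  rfl

lemma smoothFun.dir_comm (hΩ : IsOpen Ω) (v w : E) (g : smoothFun Ω) :
    dir hΩ v (dir hΩ w g) = dir hΩ w (dir hΩ v g) := by
  have key (v w : E) (p : Ω) : (dir hΩ v (dir hΩ w g)).1 p =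
      fderiv ℝ (fderiv ℝ (ext0 g)) p v w := by
    have hd : DifferentiableAt ℝ (fderiv ℝ (ext0 g)) p :=
      ((contDiffAt hΩ g p).fderiv_right (m := 1) (by norm_cast)).differentiableAt
        (by simp)
    rw [dir_apply hΩ v _ (F := fun q => fderiv ℝ (ext0 g) q w) (fun _ => rfl),
      fderiv_clm_apply hd (differentiableAt_const w)]
    simp
  ext p
  have hsymm : IsSymmSndFDerivAt ℝ (ext0 g) p :=
    (contDiffAt hΩ g p).isSymmSndFDerivAt
      (by simpa [minSmoothness_of_isRCLikeNormedField] using ENat.LEInfty.out)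
  rw [key, key]
  exact hsymm.eq v w

end SmoothFunctions

lemma isOpen_slit (n : ℕ) : IsOpen (slit n) := isOpen_ne

section Frame

variable {n : ℕ} {U : Set (Vec n)}

/-- The coordinate frame on smooth functions on `U × (ℝⁿ \ {0})`. -/
def slitFrame (hU : IsOpen U) : CoordFrame (smoothFun (U ×ˢ slit n)) n where
  X i := smoothFun.dir (hU.prod (isOpen_slit n)) (Pi.single i 1, 0)
  Y i := smoothFun.dir (hU.prod (isOpen_slit n)) (0, Pi.single i 1)
  y i := smoothFun.mk (fun p => p.2 i) (by fun_prop)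
  X_comm _ _ _ := smoothFun.dir_comm ..
  X_Y _ _ _ := smoothFun.dir_comm ..
  Y_comm _ _ _ := smoothFun.dir_comm ..
  X_y i j := by
    ext p
    rw [smoothFun.dir_apply _ _ _ (F := fun p => p.2 j) (fun _ => rfl)]
    have : HasFDerivAt (fun p : Vec n × Vec n => p.2 j)
      ((ContinuousLinearMap.proj j).comp (ContinuousLinearMap.snd ℝ (Vec n) (Vec n))) p.1 :=
      ((ContinuousLinearMap.proj j).comp
        (ContinuousLinearMap.snd ℝ (Vec n) (Vec n))).hasFDerivAt
    rw [this.fderiv]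
    simp
  Y_y i j := by
    ext p
    rw [smoothFun.dir_apply _ _ _ (F := fun p => p.2 j) (fun _ => rfl)]
    have : HasFDerivAt (fun p : Vec n × Vec n => p.2 j)
      ((ContinuousLinearMap.proj j).comp (ContinuousLinearMap.snd ℝ (Vec n) (Vec n))) p.1 :=
      ((ContinuousLinearMap.proj j).comp
        (ContinuousLinearMap.snd ℝ (Vec n) (Vec n))).hasFDerivAt
    rw [this.fderiv]
    by_cases h : j = i <;> simp [h]

/-- `F` restricts to the element `a` of the algebra of smooth functions. -/
def RestrictsTo (F : Vec n → Vec n → ℝ) (a : smoothFun (U ×ˢ slit n)) : Prop :=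
  ∀ p : (U ×ˢ slit n : Set (Vec n × Vec n)), F p.1.1 p.1.2 = a.1 p

namespace RestrictsTo

variable {F F' : Vec n → Vec n → ℝ} {a a' : smoothFun (U ×ˢ slit n)}

lemma add (h : RestrictsTo F a) (h' : RestrictsTo F' a') :
    RestrictsTo (fun x y => F x y + F' x y) (a + a') := fun p => by simp [h p, h' p]

lemma sub (h : RestrictsTo F a) (h' : RestrictsTo F' a') :
    RestrictsTo (fun x y => F x y - F' x y) (a - a') := fun p => by simp [h p, h' p]

lemma mul (h : RestrictsTo F a) (h' : RestrictsTo F' a') :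
    RestrictsTo (fun x y => F x y * F' x y) (a * a') := fun p => by simp [h p, h' p]

lemma const (r : ℝ) :
    RestrictsTo (fun _ _ => r) (algebraMap ℝ (smoothFun (U ×ˢ slit n)) r) := fun _ => rfl

lemma const_mul (r : ℝ) (h : RestrictsTo F a) :
    RestrictsTo (fun x y => r * F x y) (algebraMap ℝ _ r * a) := (const r).mul h

lemma two_mul (h : RestrictsTo F a) : RestrictsTo (fun x y => 2 * F x y) (2 * a) := by
  rw [← map_ofNat (algebraMap ℝ (smoothFun (U ×ˢ slit n))) 2]
  exact h.const_mul 2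

lemma sum {ι : Type*} {s : Finset ι} {F : ι → Vec n → Vec n → ℝ}
    {a : ι → smoothFun (U ×ˢ slit n)} (h : ∀ i, RestrictsTo (F i) (a i)) :
    RestrictsTo (fun x y => ∑ i ∈ s, F i x y) (∑ i ∈ s, a i) := fun p => by
  simp [h _ p]

lemma y (hU : IsOpen U) (i : Fin n) : RestrictsTo (fun _ y => y i) ((slitFrame hU).y i) :=
  fun _ => rfl

lemma differentiableAt (hU : IsOpen U) (h : RestrictsTo F a)
    (p : (U ×ˢ slit n : Set (Vec n × Vec n))) :
    DifferentiableAt ℝ (fun q : Vec n × Vec n => F q.1 q.2) p :=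
  (smoothFun.eventuallyEq_ext0 (hU.prod (isOpen_slit n)) a
    (F := fun q => F q.1 q.2) h p).differentiableAt_iff.2
    (smoothFun.differentiableAt (hU.prod (isOpen_slit n)) a p)

lemma pdx (hU : IsOpen U) (h : RestrictsTo F a) (i : Fin n) :
    RestrictsTo (pdx F i) ((slitFrame hU).X i a) := fun p => by
  refine Eq.trans ?_ (smoothFun.dir_apply (hU.prod (isOpen_slit n)) _ a
    (F := fun q => F q.1 q.2) h p).symm
  have hc : HasFDerivAt (fun x' : Vec n => (x', p.1.2)) _ p.1.1 :=
    hasFDerivAt_prodMk_left (𝕜 := ℝ) _ _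
  exact DFunLike.congr_fun ((h.differentiableAt hU p).hasFDerivAt.comp p.1.1 hc).fderiv _

lemma pdy (hU : IsOpen U) (h : RestrictsTo F a) (i : Fin n) :
    RestrictsTo (pdy F i) ((slitFrame hU).Y i a) := fun p => by
  refine Eq.trans ?_ (smoothFun.dir_apply (hU.prod (isOpen_slit n)) _ a
    (F := fun q => F q.1 q.2) h p).symm
  have hc : HasFDerivAt (fun y' : Vec n => (p.1.1, y')) _ p.1.2 :=
    hasFDerivAt_prodMk_right (𝕜 := ℝ) _ _
  exact DFunLike.congr_fun ((h.differentiableAt hU p).hasFDerivAt.comp p.1.2 hc).fderiv _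

lemma Y_eq_zero (hU : IsOpen U) {u : Vec n → ℝ} (h : RestrictsTo (fun x _ => u x) a)
    (i : Fin n) : (slitFrame hU).Y i a = 0 := by
  ext p
  rw [← h.pdy hU i p]
  simp [_root_.pdy]

lemma of_eq (h : RestrictsTo F a) (h' : ∀ x y, F' x y = F x y) : RestrictsTo F' a :=
  fun p => (h' _ _).trans (h p)

variable {G : Fin n → Vec n → Vec n → ℝ} {g : Fin n → smoothFun (U ×ˢ slit n)}

lemma riem (hU : IsOpen U) (h : ∀ i, RestrictsTo (G i) (g i)) (i k : Fin n) :
    RestrictsTo (Riem G i k) ((slitFrame hU).riem g i k) := by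
  rw [← CoordFrame.riem_eq]
  exact (((((h i).pdx hU k).two_mul).sub
    (sum fun j => (y hU j).mul (((h i).pdx hU j).pdy hU k))).add
    ((sum fun j => (h j).mul (((h i).pdy hU j).pdy hU k)).two_mul)).sub
    (sum fun s => ((h i).pdy hU s).mul ((h s).pdy hU k))

lemma ricci (hU : IsOpen U) (h : ∀ i, RestrictsTo (G i) (g i)) :
    RestrictsTo (Ricci G) ((slitFrame hU).ricci g) :=
  ((sum fun m => riem hU h m m).const_mul ((n : ℝ) - 1)⁻¹).of_eq fun _ _ => by
    rw [Ricci, div_eq_inv_mul]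

lemma tcurv (hU : IsOpen U) (h : ∀ i, RestrictsTo (G i) (g i)) (i k : Fin n) :
    RestrictsTo (Tcurv G i k) ((slitFrame hU).tcurv g i k) := by
  have hδ : RestrictsTo (fun _ _ => if i = k then 1 else 0)
      (if i = k then 1 else 0 : smoothFun (U ×ˢ slit n)) := fun p => by
    split_ifs <;> rfl
  exact (riem hU h i k).sub (((ricci hU h).mul hδ).sub
    ((((ricci hU h).pdy hU k).const_mul (1 / 2)).mul (y hU i)))

lemma weyl (hU : IsOpen U) (h : ∀ i, RestrictsTo (G i) (g i)) (i k : Fin n) :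
    RestrictsTo (Weyl G i k) ((slitFrame hU).weyl g i k) := by
  have hχ : RestrictsTo (chiC G k) ((slitFrame hU).chi g k) :=
    (sum fun m => (tcurv hU h m k).pdy hU m).const_mul (-(1 / 3))
  exact ((tcurv hU h i k).add ((hχ.const_mul (3 / ((n : ℝ) + 1))).mul (y hU i))).of_eq
    fun x y => by rw [Weyl]; ring

lemma hD (hU : IsOpen U) (h : ∀ i, RestrictsTo (G i) (g i)) (hF : RestrictsTo F a) (k : Fin n) :
    RestrictsTo (hD G F k) ((slitFrame hU).X k a
      - ∑ l, (slitFrame hU).Y k (g l) * (slitFrame hU).Y l a) :=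
  (hF.pdx hU k).sub (sum fun l => ((h l).pdy hU k).mul (hF.pdy hU l))

lemma berwald (hU : IsOpen U) (h : ∀ i, RestrictsTo (G i) (g i)) (hg : (slitFrame hU).IsHom2 g)
    (hF : RestrictsTo F a) (k : Fin n) :
    RestrictsTo (fun x y => _root_.hD G F k x y
      - (1 / 2) * ∑ m, covD1 G (fun j => _root_.pdy F j) k m x y * y m)
      ((slitFrame hU).berwald g a k) := by
  rw [← hg.berwald_eq]
  exact (hF.hD hU h k).sub ((sum fun m => (((hF.pdy hU k).hD hU h m).sub
    (sum fun l => (hF.pdy hU l).mul (((h l).pdy hU k).pdy hU m))).mul (y hU m)).const_mul (1 / 2))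

lemma ghat (hU : IsOpen U) (h : ∀ i, RestrictsTo (G i) (g i)) {σ : Vec n → ℝ}
    (hσ : RestrictsTo (fun x _ => Real.log (σ x)) a) (i : Fin n) :
    RestrictsTo (Ghat G σ i) (g i + (slitFrame hU).projFactor g a * (slitFrame hU).y i) := by
  have hS : RestrictsTo (Scurv G σ) (∑ m, (slitFrame hU).Y m (g m)
      - ∑ m, (slitFrame hU).y m * (slitFrame hU).X m a) :=
    (sum fun m => (h m).pdy hU m).sub (sum fun m => (y hU m).mul (hσ.pdx hU m))
  rw [CoordFrame.add_projFactor_mul_y]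
  exact ((h i).sub ((hS.const_mul ((n : ℝ) + 1)⁻¹).mul (y hU i))).of_eq fun x y => by
    rw [Ghat, div_eq_inv_mul]

/-- Euler's theorem on homogeneous functions. -/
lemma euler_eq (hU : IsOpen U) (h : RestrictsTo F a)
    (hF : ∀ x ∈ U, ∀ y ∈ slit n, ∀ c : ℝ, 0 < c → F x (c • y) = c ^ 2 * F x y) :
    (slitFrame hU).euler a = 2 * a := by
  ext p
  obtain ⟨⟨x, y⟩, hx, hy⟩ := p
  rw [CoordFrame.euler_apply,
    ← sum (s := Finset.univ) (fun j => (RestrictsTo.y hU j).mul (h.pdy hU j)) ⟨(x, y), hx, hy⟩,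
    ← h.two_mul ⟨(x, y), hx, hy⟩]
  have hd : DifferentiableAt ℝ (F x) y :=
    (h.differentiableAt hU ⟨(x, y), hx, hy⟩).comp y (hasFDerivAt_prodMk_right x y).differentiableAt
  have hsum : ∑ j, y j * _root_.pdy F j x y = fderiv ℝ (F x) y y := by
    conv_rhs => enter [2]; rw [pi_eq_sum_univ' y]
    simp [_root_.pdy]
  have h1 : HasDerivAt (fun c : ℝ => F x (c • y)) (fderiv ℝ (F x) y y) 1 := by
    have hl : HasDerivAt (fun c : ℝ => c • y) y 1 := by
      simpa using (hasDerivAt_id (1 : ℝ)).smul_const y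
    exact HasFDerivAt.comp_hasDerivAt (1 : ℝ) (by simpa using hd.hasFDerivAt) hl
  have h2 : HasDerivAt (fun c : ℝ => F x (c • y)) (2 * F x y) 1 := by
    have hp : HasDerivAt (fun c : ℝ => c ^ 2 * F x y) (2 * F x y) 1 := by
      simpa using (hasDerivAt_pow 2 (1 : ℝ)).mul_const (F x y)
    refine hp.congr_of_eventuallyEq ?_
    filter_upwards [lt_mem_nhds one_pos] with c hc using hF x hx y hy c hc
  exact hsum.trans (h1.unique h2)

end RestrictsTo

lemma exists_restrictsTo {F : Vec n → Vec n → ℝ}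
    (hF : ContDiffOn ℝ (⊤ : ℕ∞) (fun p : Vec n × Vec n => F p.1 p.2) (U ×ˢ slit n)) :
    ∃ a : smoothFun (U ×ˢ slit n), RestrictsTo F a :=
  ⟨smoothFun.mk _ hF, fun _ => rfl⟩

lemma exists_restrictsTo_base {u : Vec n → ℝ} (hu : ContDiffOn ℝ (⊤ : ℕ∞) u U) :
    ∃ a : smoothFun (U ×ˢ slit n), RestrictsTo (fun x _ => u x) a :=
  exists_restrictsTo (hu.comp contDiffOn_fst fun _ hp => hp.1)

end Frame

/-- Equation (4.7): if `σ = e^{(n+1)f} σ̃`, then the Berwald–Weyl curvatures are related by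
`W̃^o_k = W^o_k - W^m_k f_{x^m}`. -/
theorem stmt_15 {n : ℕ} (hn : 2 ≤ n) (U : Set (Vec n)) (hU : IsOpen U) (hUne : U.Nonempty)
    (G : Fin n → Vec n → Vec n → ℝ) (hG : IsSpray U G)
    (σ σt : Vec n → ℝ) (hσ : IsVolumeForm U σ) (hσt : IsVolumeForm U σt)
    (f : Vec n → ℝ) (hf : ContDiffOn ℝ (⊤ : ℕ∞) f U)
    (hrel : ∀ x ∈ U, σ x = Real.exp (((n : ℝ) + 1) * f x) * σt x) :
    ∀ x ∈ U, ∀ y ∈ slit n, ∀ k : Fin n,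
      BWeyl G σt k x y =
        BWeyl G σ k x y - ∑ m, Weyl G m k x y * fderiv ℝ f x (Pi.single m 1) := by
  intro x hx y hy k
  have hlog {τ : Vec n → ℝ} (hτ : IsVolumeForm U τ) :
      ContDiffOn ℝ (⊤ : ℕ∞) (fun x => Real.log (τ x)) U :=
    hτ.1.log fun x hx => (hτ.2 x hx).ne'
  choose g hg using fun i => exists_restrictsTo (hG.1 i)
  obtain ⟨a, ha⟩ := exists_restrictsTo_base (hlog hσ)
  obtain ⟨b, hb⟩ := exists_restrictsTo_base (hlog hσt)
  obtain ⟨c, hc⟩ := exists_restrictsTo_base hf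
  have hhom : (slitFrame hU).IsHom2 g := fun i => (hg i).euler_eq hU (hG.2 i)
  have hab : a = algebraMap ℝ _ ((n : ℝ) + 1) * c + b := by
    ext p
    rw [← ha p, ← (hc.const_mul ((n : ℝ) + 1)).add hb p]
    dsimp only
    rw [hrel _ p.2.1,
      Real.log_mul (Real.exp_ne_zero _) (hσt.2 _ p.2.1).ne', Real.log_exp]
  have hB {τ : Vec n → ℝ} {e : smoothFun (U ×ˢ slit n)}
      (he : RestrictsTo (fun x _ => Real.log (τ x)) e) :=
    RestrictsTo.berwald hU (RestrictsTo.ghat hU hg he)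
      (hhom.add_mul_y (hhom.euler_projFactor (he.Y_eq_zero hU)))
      (RestrictsTo.ricci hU (RestrictsTo.ghat hU hg he)) k
  have key := hhom.berwald_projective hn (ha.Y_eq_zero hU) (hc.Y_eq_zero hU) hab k
  have hrhs := (hB ha).sub (RestrictsTo.sum (s := Finset.univ) fun m =>
    (RestrictsTo.weyl hU hg m k).mul (hc.pdx hU m))
  rw [← key] at hrhs
  exact (hB hb ⟨(x, y), hx, hy⟩).trans (hrhs ⟨(x, y), hx, hy⟩).symm

end BerwaldWeyl
end
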